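/- Let D be a convex drawing of K_n in the plane with star vertex v_⋆, with m ≥ 2 bad edges and a labeling satisfying sidedness and nestedness, bad edges b_i = {v_i, v_i+1} with v_1 < … < v_m, smallest and largest witnesses w_i^L and w_i^R of b_i, and for 1 ≤ i ≤ m−1 let L_i = {x : w_{i+1}^R < x < w_i^L} and R_i = {x : v_i + 1 ≤ x ≤ v_{i+1}}. Fix i with 1 ≤ i ≤ m−1, let u ∈ L_i and v ∈ R_i, and let z be the largest element of L_i with z > u such that the edge {u,v} crosses the star edge {z, v_⋆}. Then: (a) the edge {z, v} is not star-crossing; and (b) the edge {z+1, v} does not cross any star edge {x', v_⋆} with x' ∈ L_i and x' ≤ z. -/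

import Mathlib

open Set

/-- Cyclic successor on `Fin m` (indices modulo `m`). -/
def finCycSucc {m : ℕ} (i : Fin m) : Fin m := ⟨((i : ℕ) + 1) % m, Nat.mod_lt _ i.pos⟩

/-- `p` is a proper (transversal) crossing point of the arcs `α` and `β` : `p` lies on both arcs
and, locally around `p`, the arc `β` has points in two different sides of `α`
(it passes from one side of `α` to the other). -/
def ProperCrossingAt (α β : Set (ℝ × ℝ)) (p : ℝ × ℝ) : Prop :=
  p ∈ α ∩ β ∧
    ∀ U ∈ nhds p, ∃ V ∈ nhds p, V ⊆ U ∧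
      ∃ q₁ ∈ β ∩ V, ∃ q₂ ∈ β ∩ V, q₁ ∉ α ∧ q₂ ∉ α ∧
        connectedComponentIn (V \ α) q₁ ≠ connectedComponentIn (V \ α) q₂

/-- A simple drawing of the complete graph `K n` in the plane: `n` distinct vertex points,
a simple arc joining each pair of distinct vertices, no edge passing through another vertex,
and any two (distinct) edges meeting in at most one point, which is either a common endpoint
or a proper crossing. -/
structure SimpleDrawing (n : ℕ) where
  vert : Fin n → ℝ × ℝ
  vert_inj : Function.Injective vert
  arc : Fin n → Fin n → Set (ℝ × ℝ)
  arc_symm : ∀ i j, arc i j = arc j i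
  arc_simple : ∀ i j, i ≠ j → ∃ f : ℝ → ℝ × ℝ,
    ContinuousOn f (Icc (0:ℝ) 1) ∧ InjOn f (Icc (0:ℝ) 1) ∧
    f '' Icc (0:ℝ) 1 = arc i j ∧ f 0 = vert i ∧ f 1 = vert j
  no_through_vertex : ∀ i j k, i ≠ j → vert k ∈ arc i j → k = i ∨ k = j
  inter_subsingleton : ∀ i j k l, i ≠ j → k ≠ l → s(i, j) ≠ s(k, l) →
    (arc i j ∩ arc k l).Subsingleton
  inter_proper : ∀ i j k l, i ≠ j → k ≠ l → s(i, j) ≠ s(k, l) →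
    ∀ p ∈ arc i j ∩ arc k l,
      (∃ a, (a = i ∨ a = j) ∧ (a = k ∨ a = l) ∧ p = vert a) ∨
      ProperCrossingAt (arc i j) (arc k l) p

namespace SimpleDrawing

variable {n : ℕ} (D : SimpleDrawing n)

/-- The arc realizing an (unordered) edge. -/
def earc : Sym2 (Fin n) → Set (ℝ × ℝ) := Sym2.lift ⟨D.arc, D.arc_symm⟩

/-- Two (distinct) edges cross: they share a point that is not a common endpoint. -/
def Crosses (e e' : Sym2 (Fin n)) : Prop :=
  e ≠ e' ∧ ∃ p ∈ D.earc e ∩ D.earc e', ¬∃ a, a ∈ e ∧ a ∈ e' ∧ p = D.vert a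

/-- A set of edges is plane if no two of its edges cross. -/
def IsPlane (E : Set (Sym2 (Fin n))) : Prop :=
  ∀ e ∈ E, ∀ e' ∈ E, ¬D.Crosses e e'

/-- A plane subdrawing: a plane set of (genuine, non-loop) edges of the drawing. -/
def IsPlaneSub (E : Set (Sym2 (Fin n))) : Prop :=
  (∀ e ∈ E, ¬e.IsDiag) ∧ D.IsPlane E

/-- A maximal plane subdrawing: no further edge can be added while keeping the set plane. -/
def IsMaximalPlaneSub (E : Set (Sym2 (Fin n))) : Prop :=
  D.IsPlaneSub E ∧ ∀ e, ¬e.IsDiag → e ∉ E → ¬D.IsPlaneSub (insert e E)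

/-- The triangle of the drawing spanned by three vertices: the union of the three arcs. -/
def triangle (a b c : Fin n) : Set (ℝ × ℝ) := D.arc a b ∪ D.arc b c ∪ D.arc a c

/-- `S` is a side of the triangle on `a b c`: the closure of a connected component of the
complement of the triangle. -/
def IsSideOf (S : Set (ℝ × ℝ)) (a b c : Fin n) : Prop :=
  ∃ p, p ∉ D.triangle a b c ∧ S = closure (connectedComponentIn (D.triangle a b c)ᶜ p)

/-- `S` is a convex side of the triangle on `a b c`: every edge of the drawing with both
endpoints in `S` is contained in `S`. -/
def IsConvexSideOf (S : Set (ℝ × ℝ)) (a b c : Fin n) : Prop :=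
  D.IsSideOf S a b c ∧
    ∀ i j : Fin n, i ≠ j → D.vert i ∈ S → D.vert j ∈ S → D.arc i j ⊆ S

/-- A convex drawing: every triangle has a convex side. -/
def Convex : Prop :=
  ∀ a b c : Fin n, a ≠ b → b ≠ c → a ≠ c → ∃ S, D.IsConvexSideOf S a b c

/-- A plane Hamiltonian cycle: a plane set of `n` edges forming a cycle through all vertices. -/
def IsPlaneHamCycle (E : Set (Sym2 (Fin n))) : Prop :=
  D.IsPlane E ∧ ∃ c : ZMod n → Fin n, Function.Bijective c ∧
    E = {e | ∃ k : ZMod n, e = s(c k, c (k + 1))}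

/-- A plane Hamiltonian path from `s` to `t`: a plane set of `n-1` edges forming a path
through all `n` vertices with endpoints `s` and `t`. -/
def IsPlaneHamPath (E : Set (Sym2 (Fin n))) (s t : Fin n) : Prop :=
  D.IsPlane E ∧ ∃ p : Fin n → Fin n, Function.Bijective p ∧
    (∀ i : Fin n, (i : ℕ) = 0 → p i = s) ∧
    (∀ i : Fin n, (i : ℕ) = n - 1 → p i = t) ∧
    E = {e | ∃ i j : Fin n, (j : ℕ) = (i : ℕ) + 1 ∧ e = s(p i, p j)}

/-- The edge from `a` towards `b` emanates (at `a`) into the set `C`. -/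
def EmanatesInto (a b : Fin n) (C : Set (ℝ × ℝ)) : Prop :=
  ∃ U ∈ nhds (D.vert a), (D.arc a b ∩ U) \ {D.vert a} ⊆ C

/-- At the vertex `vs`, the edges towards `b` and towards `d` emanate into different
connected components of the complement of the triangle on `vs`, `a`, `c`;
i.e. the pair `{a, c}` locally separates `b` from `d` in the rotation at `vs`. -/
def SeparatesAt (vs a c b d : Fin n) : Prop :=
  ∃ p q : ℝ × ℝ, p ∉ D.triangle vs a c ∧ q ∉ D.triangle vs a c ∧
    connectedComponentIn (D.triangle vs a c)ᶜ p ≠ connectedComponentIn (D.triangle vs a c)ᶜ q ∧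
    D.EmanatesInto vs b (connectedComponentIn (D.triangle vs a c)ᶜ p) ∧
    D.EmanatesInto vs d (connectedComponentIn (D.triangle vs a c)ᶜ q)

/-- `lab` labels the `n-1` non-star vertices according to the cyclic order (the rotation)
in which the star edges emanate from the star vertex `vs`: it is a bijection onto the
non-star vertices such that, for any indices `i < j < k < l`, the edges towards `lab i` and
`lab k` locally separate the edges towards `lab j` and `lab l` at `vs`. -/
def IsRotationLabeling (vs : Fin n) (lab : Fin (n - 1) → Fin n) : Prop :=
  Function.Injective lab ∧ range lab = {x | x ≠ vs} ∧
    ∀ i j k l : Fin (n - 1), i < j → j < k → k < l →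
      D.SeparatesAt vs (lab i) (lab k) (lab j) (lab l)

/-- The edge `{lab x, lab (x+1)}` (indices mod `n-1`) is a bad edge with witness `w`:
it crosses the star edge `{lab w, vs}`. -/
def BadWitness (vs : Fin n) (lab : Fin (n - 1) → Fin n) (x w : Fin (n - 1)) : Prop :=
  D.Crosses s(lab x, lab (finCycSucc x)) s(lab w, vs)

/-- The non-star edge `{lab x, lab y}` is star-crossing: it crosses some star edge. -/
def StarCrossing (vs : Fin n) (lab : Fin (n - 1) → Fin n) (x y : Fin (n - 1)) : Prop :=
  ∃ w : Fin (n - 1), D.Crosses s(lab x, lab y) s(lab w, vs)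

end SimpleDrawing

/-- Four indices appear in this cyclic order. -/
def CyclicOrdered {m : ℕ} (a b c d : Fin m) : Prop :=
  (a < b ∧ b < c ∧ c < d) ∨ (b < c ∧ c < d ∧ d < a) ∨
  (c < d ∧ d < a ∧ a < b) ∨ (d < a ∧ a < b ∧ b < c)

namespace PlaneCurve

open Complex Topology Filter

/-- The identification of the plane with `ℂ`. -/
noncomputable def cx : (ℝ × ℝ) ≃L[ℝ] ℂ := Complex.equivRealProdCLM.symm

theorem exists_continuous_log {X : Type*} [TopologicalSpace X] [LocallyPathConnectedSpace X]
    [ContractibleSpace X] {g : X → ℂ} (hg : Continuous g) (h0 : ∀ x, g x ≠ 0) :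
    ∃ L : X → ℂ, Continuous L ∧ ∀ x, exp (L x) = g x := by
  obtain ⟨x₀⟩ : Nonempty X := inferInstance
  obtain ⟨f, ⟨-, hf⟩, -⟩ := isCoveringMapOn_exp.existsUnique_continuousMap_lifts
    (⟨g, hg⟩ : C(X, ℂ)) (a₀ := x₀) (exp_log (h0 x₀)) (fun x ↦ by simpa using h0 x)
  exact ⟨f, f.continuous, fun x ↦ congrFun hf x⟩

theorem eq_of_exp_eq_one {X : Type*} [TopologicalSpace X] {S : Set X} (hS : IsPreconnected S)
    {k : X → ℂ} (hk : ContinuousOn k S) (h1 : ∀ x ∈ S, exp (k x) = 1) {x y : X}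
    (hx : x ∈ S) (hy : y ∈ S) : k x = k y := by
  have hpi : (2 * Real.pi) ≠ 0 := by positivity
  have key : ∀ x ∈ S, ∃ n : ℤ, k x = n * (2 * Real.pi * I) := fun x hx ↦
    exp_eq_one_iff.1 (h1 x hx)
  have him : ∀ x ∈ S, ∀ n : ℤ, k x = n * (2 * Real.pi * I) → (k x).im / (2 * Real.pi) = n := by
    intro x hx n hn
    rw [hn]
    simp
  have hc : ContinuousOn (fun x ↦ (k x).im / (2 * Real.pi)) S :=
    (continuous_im.comp_continuousOn hk).div_const _
  have hpre := (hS.image _ hc).ordConnected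
  obtain ⟨a, ha⟩ := key x hx
  obtain ⟨b, hb⟩ := key y hy
  have hab : ∀ x ∈ S, ∀ y ∈ S, ∀ a b : ℤ, k x = a * (2 * Real.pi * I) →
      k y = b * (2 * Real.pi * I) → ¬ a < b := by
    intro x hx y hy a b ha hb hlt
    have hmem : ((a : ℝ) + 1 / 2) ∈ (fun x ↦ (k x).im / (2 * Real.pi)) '' S := by
      refine hpre.out ⟨x, hx, him x hx a ha⟩ ⟨y, hy, him y hy b hb⟩ ⟨by linarith, ?_⟩
      have : ((a + 1 : ℤ) : ℝ) ≤ b := by exact_mod_cast hlt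
      push_cast at this
      linarith
    obtain ⟨w, hw, hw2⟩ := hmem
    obtain ⟨c, hc⟩ := key w hw
    have h3 := him w hw c hc
    simp only at hw2
    rw [h3] at hw2
    have h4 : (2 * c : ℝ) = 2 * a + 1 := by linarith
    have h5 : 2 * c = 2 * a + 1 := by exact_mod_cast h4
    omega
  have : a = b := le_antisymm (not_lt.1 (hab y hy x hx b a hb ha))
    (not_lt.1 (hab x hx y hy a b ha hb))
  rw [ha, hb, this]

theorem sub_eq_sub_of_exp_eq {X : Type*} [TopologicalSpace X] {S : Set X} (hS : IsPreconnected S)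
    {k l : X → ℂ} (hk : ContinuousOn k S) (hl : ContinuousOn l S)
    (h1 : ∀ x ∈ S, exp (k x) = exp (l x)) {x y : X}
    (hx : x ∈ S) (hy : y ∈ S) : k y - k x = l y - l x := by
  have := eq_of_exp_eq_one hS (hk.sub hl)
    (fun x hx ↦ by rw [Pi.sub_apply, exp_sub, h1 x hx, div_self (exp_ne_zero _)]) hx hy
  simp only [Pi.sub_apply] at this
  linear_combination -this

/-- `L` is a continuous branch on `A` of the logarithm of the displacement from `R`. -/
def IsLogOn (A : Set (ℝ × ℝ)) (R : ℝ × ℝ) (L : ℝ × ℝ → ℂ) : Prop :=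
  ContinuousOn L A ∧ ∀ z ∈ A, exp (L z) = cx z - cx R

/-- Every point off `A` admits a branch of the logarithm of the displacement on `A`. -/
def HasLogs (A : Set (ℝ × ℝ)) : Prop := ∀ R ∉ A, ∃ L, IsLogOn A R L

open Classical in
/-- Variation along `A`, from `x` to `y`, of the logarithm of the displacement from `R`. -/
noncomputable def dlog (A : Set (ℝ × ℝ)) (x y R : ℝ × ℝ) : ℂ :=
  if h : ∃ L, IsLogOn A R L then h.choose y - h.choose x else 0

theorem dlog_eq {A : Set (ℝ × ℝ)} (hA : IsPreconnected A) {R : ℝ × ℝ} {L : ℝ × ℝ → ℂ}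
    (hL : IsLogOn A R L) {x y : ℝ × ℝ} (hx : x ∈ A) (hy : y ∈ A) :
    dlog A x y R = L y - L x := by
  have h : ∃ L, IsLogOn A R L := ⟨L, hL⟩
  rw [dlog, dif_pos h]
  exact sub_eq_sub_of_exp_eq hA h.choose_spec.1 hL.1
    (fun z hz ↦ by rw [h.choose_spec.2 z hz, hL.2 z hz]) hx hy

theorem dlog_antisymm (A : Set (ℝ × ℝ)) (x y R : ℝ × ℝ) : dlog A y x R = - dlog A x y R := by
  unfold dlog
  split_ifs <;> simp

theorem exp_dlog {A : Set (ℝ × ℝ)} {R : ℝ × ℝ} (h : ∃ L, IsLogOn A R L) {x y : ℝ × ℝ}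
    (hx : x ∈ A) (hy : y ∈ A) :
    exp (dlog A x y R) = (cx y - cx R) / (cx x - cx R) := by
  rw [dlog, dif_pos h, exp_sub, h.choose_spec.2 _ hx, h.choose_spec.2 _ hy]

theorem exists_glue {A B : Set (ℝ × ℝ)} (hA : IsClosed A) (hB : IsClosed B) {f g : ℝ × ℝ → ℂ}
    (hf : ContinuousOn f A) (hg : ContinuousOn g B) (h : ∀ x ∈ A ∩ B, f x = g x) :
    ∃ F : ℝ × ℝ → ℂ, ContinuousOn F (A ∪ B) ∧ (∀ x ∈ A, F x = f x) ∧ ∀ x ∈ B, F x = g x := by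
  classical
  have h1 : ∀ x ∈ A, A.piecewise f g x = f x := fun x hx ↦ piecewise_eq_of_mem _ _ _ hx
  have h2 : ∀ x ∈ B, A.piecewise f g x = g x := fun x hx ↦ by
    by_cases hxA : x ∈ A
    · rw [h1 x hxA, h x ⟨hxA, hx⟩]
    · exact piecewise_eq_of_notMem _ _ _ hxA
  exact ⟨A.piecewise f g, (hf.congr h1).union_of_isClosed (hg.congr h2) hA hB, h1, h2⟩

theorem IsLogOn.mono {A B : Set (ℝ × ℝ)} {R : ℝ × ℝ} {L : ℝ × ℝ → ℂ} (h : IsLogOn A R L)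
    (hBA : B ⊆ A) : IsLogOn B R L := ⟨h.1.mono hBA, fun z hz ↦ h.2 z (hBA hz)⟩

/-- Logarithms of `g` on two closed sets meeting in one point glue. -/
theorem exists_log_union {A B : Set (ℝ × ℝ)} (hA : IsClosed A) (hB : IsClosed B)
    {p : ℝ × ℝ} (hp : A ∩ B = {p}) {g L M : ℝ × ℝ → ℂ} (hL : ContinuousOn L A)
    (hL2 : ∀ z ∈ A, exp (L z) = g z) (hM : ContinuousOn M B) (hM2 : ∀ z ∈ B, exp (M z) = g z) :
    ∃ N : ℝ × ℝ → ℂ, ContinuousOn N (A ∪ B) ∧ (∀ z ∈ A ∪ B, exp (N z) = g z) ∧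
      (∀ x ∈ A, N x = L x) ∧ ∀ x ∈ B, N x = M x + (L p - M p) := by
  have hpA : p ∈ A ∩ B := by rw [hp]; rfl
  obtain ⟨F, hF, hFA, hFB⟩ := exists_glue hA hB hL (g := fun x ↦ M x + (L p - M p))
    (hM.add continuousOn_const) (fun x hx ↦ by
      rw [hp] at hx
      rw [mem_singleton_iff.1 hx]; ring)
  refine ⟨F, hF, ?_, hFA, hFB⟩
  rintro x (hx | hx)
  · rw [hFA x hx, hL2 x hx]
  · have hne : exp (M p) ≠ 0 := exp_ne_zero _
    rw [hFB x hx, exp_add, exp_sub, hM2 x hx, hL2 p hpA.1, ← hM2 p hpA.2, div_self hne, mul_one]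

theorem HasLogs.union {A B : Set (ℝ × ℝ)} (hA : IsClosed A) (hB : IsClosed B)
    {p : ℝ × ℝ} (hp : A ∩ B = {p}) (hLA : HasLogs A) (hLB : HasLogs B) : HasLogs (A ∪ B) := by
  intro R hR
  obtain ⟨L, hL⟩ := hLA R (fun h ↦ hR (Or.inl h))
  obtain ⟨M, hM⟩ := hLB R (fun h ↦ hR (Or.inr h))
  obtain ⟨N, hN, hN2, -⟩ := exists_log_union hA hB hp hL.1 hL.2 hM.1 hM.2
  exact ⟨N, hN, hN2⟩

/-- `A` is a simple arc from `x` to `y`. -/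
def IsArc (A : Set (ℝ × ℝ)) (x y : ℝ × ℝ) : Prop :=
  ∃ f : ℝ → ℝ × ℝ, Continuous f ∧ (∀ t, f t ∈ A) ∧ InjOn f (Icc (0:ℝ) 1) ∧
    f '' Icc (0:ℝ) 1 = A ∧ f 0 = x ∧ f 1 = y

theorem isArc_of_continuousOn {A : Set (ℝ × ℝ)} {x y : ℝ × ℝ} {f : ℝ → ℝ × ℝ}
    (hf : ContinuousOn f (Icc (0:ℝ) 1)) (hinj : InjOn f (Icc (0:ℝ) 1))
    (hA : f '' Icc (0:ℝ) 1 = A) (h0 : f 0 = x) (h1 : f 1 = y) : IsArc A x y := by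
  have h01 : (0:ℝ) ≤ 1 := zero_le_one
  have e : EqOn (fun t ↦ f (projIcc 0 1 h01 t)) f (Icc (0:ℝ) 1) := fun t ht ↦ by
    simp only [projIcc_of_mem h01 ht]
  refine ⟨fun t ↦ f (projIcc 0 1 h01 t), ?_, ?_, hinj.congr e.symm, by rw [e.image_eq, hA], ?_, ?_⟩
  · exact hf.comp_continuous (continuous_subtype_val.comp continuous_projIcc)
      (fun t ↦ (projIcc 0 1 h01 t).2)
  · intro t
    rw [← hA]
    exact mem_image_of_mem _ (projIcc 0 1 h01 t).2
  · rw [← h0]; exact e (left_mem_Icc.2 h01)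
  · rw [← h1]; exact e (right_mem_Icc.2 h01)

/-- Restriction of a parametrized arc to a subinterval. -/
theorem isArc_image_Icc {f : ℝ → ℝ × ℝ} (hf : Continuous f) (hinj : InjOn f (Icc (0:ℝ) 1))
    {a b : ℝ} (ha : 0 ≤ a) (hab : a < b) (hb : b ≤ 1) : IsArc (f '' Icc a b) (f a) (f b) := by
  have him : (fun t ↦ a + t * (b - a)) '' Icc (0:ℝ) 1 = Icc a b := by
    ext s
    simp only [mem_image, mem_Icc]
    constructor
    · rintro ⟨t, ⟨h0, h1⟩, rfl⟩
      constructor <;> nlinarith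
    · rintro ⟨h0, h1⟩
      refine ⟨(s - a) / (b - a), ⟨div_nonneg (by linarith) (by linarith),
        (div_le_one (by linarith)).2 (by linarith)⟩, ?_⟩
      field_simp [sub_ne_zero.2 hab.ne']
      ring
  refine isArc_of_continuousOn (f := f ∘ fun t ↦ a + t * (b - a)) (by fun_prop) ?_ ?_ ?_ ?_
  · refine hinj.comp (fun s _ t _ h ↦ ?_) ?_
    · have : (s - t) * (b - a) = 0 := by linarith [show a + s * (b - a) = a + t * (b - a) from h]
      rcases mul_eq_zero.1 this with h | h <;> linarith
    · intro t ht
      have : a + t * (b - a) ∈ Icc a b := him ▸ mem_image_of_mem _ ht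
      exact ⟨ha.trans this.1, this.2.trans hb⟩
  · rw [image_comp, him]
  · simp
  · simp

namespace IsArc

variable {A B : Set (ℝ × ℝ)} {x y a b c d R : ℝ × ℝ}

theorem isCompact (h : IsArc A x y) : IsCompact A := by
  obtain ⟨f, hf, -, -, rfl, -⟩ := h
  exact isCompact_Icc.image hf

theorem isClosed (h : IsArc A x y) : IsClosed A := h.isCompact.isClosed

theorem isPreconnected (h : IsArc A x y) : IsPreconnected A := by
  obtain ⟨f, hf, -, -, rfl, -⟩ := h
  exact isPreconnected_Icc.image _ hf.continuousOn

theorem left_mem (h : IsArc A x y) : x ∈ A := by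
  obtain ⟨f, hf, hA, -, -, rfl, -⟩ := h
  exact hA 0

theorem right_mem (h : IsArc A x y) : y ∈ A := by
  obtain ⟨f, hf, hA, -, -, -, rfl⟩ := h
  exact hA 1

theorem ne (h : IsArc A x y) : x ≠ y := by
  obtain ⟨f, hf, hA, hi, -, rfl, rfl⟩ := h
  exact fun h ↦ zero_ne_one (hi ⟨le_rfl, zero_le_one⟩ ⟨zero_le_one, le_rfl⟩ h)

theorem symm (h : IsArc A x y) : IsArc A y x := by
  obtain ⟨f, hf, hA, hi, hA2, rfl, rfl⟩ := h
  have him : (fun t : ℝ ↦ 1 - t) '' Icc (0:ℝ) 1 = Icc 0 1 := by simp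
  refine isArc_of_continuousOn (f := f ∘ fun t ↦ 1 - t) (by fun_prop) ?_ ?_ (by simp) (by simp)
  · exact hi.comp (fun s _ t _ h ↦ by linarith [show 1 - s = 1 - t from h])
      (fun t ht ↦ him ▸ mem_image_of_mem _ ht)
  · rw [image_comp, him, hA2]

theorem hasLogs (h : IsArc A x y) : HasLogs A := by
  obtain ⟨f, hf, hA, hi, hA2, rfl, rfl⟩ := h
  intro R hR
  obtain ⟨Λ, hΛ, hexp⟩ := exists_continuous_log (g := fun t ↦ cx (f t) - cx R) (by fun_prop)
    (fun t ↦ sub_ne_zero.2 fun h ↦ hR (cx.injective h ▸ hA t))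
  let F : Icc (0:ℝ) 1 → ℝ × ℝ := fun t ↦ f t
  have hF : Topology.IsClosedEmbedding F := by
    apply Continuous.isClosedEmbedding (by fun_prop)
    intro s t hst
    exact Subtype.ext (hi s.2 t.2 hst)
  have hrange : range F = A := by rw [← hA2, image_eq_range]
  let e := hF.isEmbedding.toHomeomorph
  have he : ∀ z : range F, f (e.symm z) = z := fun z ↦ congrArg Subtype.val (e.apply_symm_apply z)
  classical
  refine ⟨fun z ↦ if hz : z ∈ range F then Λ (e.symm ⟨z, hz⟩) else 0, ?_, ?_⟩
  · rw [← hrange, continuousOn_iff_continuous_domRestrict]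
    have : (range F).domRestrict (fun z ↦ if hz : z ∈ range F then Λ (e.symm ⟨z, hz⟩) else 0) =
        fun z ↦ Λ (e.symm z) := by
      ext z
      simp only [domRestrict_apply]
      rw [dif_pos z.2]
    rw [this]
    fun_prop
  · intro z hz
    rw [← hrange] at hz
    simp only
    rw [dif_pos hz, hexp, he ⟨z, hz⟩]

theorem dlog_comp (h : IsArc A x y) (hR : R ∉ A) {f : ℝ → ℝ × ℝ} (hf : Continuous f)
    (hfA : ∀ t, f t ∈ A) {Λ : ℝ → ℂ} (hΛ : Continuous Λ)
    (hexp : ∀ t, exp (Λ t) = cx (f t) - cx R) (s t : ℝ) :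
    dlog A (f s) (f t) R = Λ t - Λ s := by
  obtain ⟨L, hL⟩ := h.hasLogs R hR
  rw [dlog_eq h.isPreconnected hL (hfA s) (hfA t)]
  exact sub_eq_sub_of_exp_eq (k := fun t ↦ L (f t)) isPreconnected_univ
    (hL.1.comp_continuous hf hfA).continuousOn hΛ.continuousOn
    (fun t _ ↦ by rw [hL.2 _ (hfA t), hexp t]) (mem_univ s) (mem_univ t)

/-- Reciprocity for two disjoint arcs. -/
theorem dlog_reciprocity (hA : IsArc A a b) (hB : IsArc B c d) (hAB : Disjoint A B) :
    dlog A a b d - dlog A a b c = dlog B c d b - dlog B c d a := by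
  obtain ⟨f, hf, hfA, -, -, rfl, rfl⟩ := id hA
  obtain ⟨g, hg, hgB, -, -, rfl, rfl⟩ := id hB
  obtain ⟨G, hG, hexp⟩ := exists_continuous_log (g := fun p : ℝ × ℝ ↦ cx (f p.1) - cx (g p.2))
    (by fun_prop) (fun p ↦ sub_ne_zero.2 fun h ↦
      hAB.ne_of_mem (hfA p.1) (hgB p.2) (cx.injective h))
  have hAt : ∀ t, g t ∉ A := fun t h ↦ disjoint_left.1 hAB h (hgB t)
  have hBt : ∀ t, f t ∉ B := fun t h ↦ disjoint_left.1 hAB (hfA t) h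
  have h1 : ∀ t, dlog A (f 0) (f 1) (g t) = G (1, t) - G (0, t) := fun t ↦
    hA.dlog_comp (hAt t) hf hfA (Λ := fun s ↦ G (s, t)) (by fun_prop) (fun s ↦ hexp (s, t)) 0 1
  have h2 : ∀ s, dlog B (g 0) (g 1) (f s) = (G (s, 1) + Real.pi * I) - (G (s, 0) + Real.pi * I) :=
    fun s ↦ hB.dlog_comp (hBt s) hg hgB (Λ := fun t ↦ G (s, t) + Real.pi * I) (by fun_prop)
      (fun t ↦ by rw [exp_add, hexp, exp_pi_mul_I]; ring) 0 1
  rw [h1, h1, h2, h2]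
  ring

/-- Additivity of `dlog` when an arc is cut at an interior point. -/
theorem dlog_add (hA : IsArc A a b) {A₁ A₂ : Set (ℝ × ℝ)} {p : ℝ × ℝ} (h₁ : IsArc A₁ a p)
    (h₂ : IsArc A₂ p b) (hs₁ : A₁ ⊆ A) (hs₂ : A₂ ⊆ A) (hR : R ∉ A) :
    dlog A a b R = dlog A₁ a p R + dlog A₂ p b R := by
  obtain ⟨L, hL⟩ := hA.hasLogs R hR
  rw [dlog_eq hA.isPreconnected hL hA.left_mem hA.right_mem,
    dlog_eq h₁.isPreconnected (hL.mono hs₁) h₁.left_mem h₁.right_mem,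
    dlog_eq h₂.isPreconnected (hL.mono hs₂) h₂.left_mem h₂.right_mem]
  ring

theorem exp_dlog (hA : IsArc A a b) (hR : R ∉ A) :
    exp (dlog A a b R) = (cx b - cx R) / (cx a - cx R) :=
  PlaneCurve.exp_dlog (hA.hasLogs R hR) hA.left_mem hA.right_mem

/-- Cutting an arc at an interior point. -/
theorem split (hA : IsArc A a b) {p : ℝ × ℝ} (hp : p ∈ A) (hpa : p ≠ a) (hpb : p ≠ b) :
    ∃ A₁ A₂, IsArc A₁ a p ∧ IsArc A₂ p b ∧ A₁ ∪ A₂ = A ∧ A₁ ∩ A₂ = {p} := by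
  obtain ⟨f, hf, hfA, hi, rfl, rfl, rfl⟩ := hA
  obtain ⟨t, ⟨ht0, ht1⟩, rfl⟩ := hp
  have h0 : 0 < t := lt_of_le_of_ne ht0 (fun h ↦ hpa (by rw [h]))
  have h1 : t < 1 := lt_of_le_of_ne ht1 (fun h ↦ hpb (by rw [h]))
  refine ⟨f '' Icc 0 t, f '' Icc t 1, isArc_image_Icc hf hi le_rfl h0 ht1,
    isArc_image_Icc hf hi ht0 h1 le_rfl, by rw [← image_union, Icc_union_Icc_eq_Icc ht0 ht1], ?_⟩
  rw [← hi.image_inter (Icc_subset_Icc_right ht1) (Icc_subset_Icc_left ht0),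
    Icc_inter_Icc_eq_singleton ht0 ht1, image_singleton]

/-- An arc has a short initial piece inside any given neighbourhood of its first endpoint. -/
theorem exists_initial (hA : IsArc A a b) {U : Set (ℝ × ℝ)} (hU : U ∈ 𝓝 a) :
    ∃ r A₁ A₂, IsArc A₁ a r ∧ IsArc A₂ r b ∧ A₁ ∪ A₂ = A ∧ A₁ ∩ A₂ = {r} ∧ A₁ ⊆ U ∧ r ≠ a ∧
      r ≠ b := by
  obtain ⟨f, hf, hfA, hi, rfl, rfl, rfl⟩ := id hA
  obtain ⟨ε, hε, hball⟩ := Metric.mem_nhds_iff.1 (hf.continuousAt.preimage_mem_nhds hU)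
  set t := min (ε / 2) (1 / 2) with ht
  have h0 : 0 < t := by positivity
  have h1 : t < 1 := (min_le_right _ _).trans_lt (by norm_num)
  refine ⟨f t, f '' Icc 0 t, f '' Icc t 1, isArc_image_Icc hf hi le_rfl h0 h1.le,
    isArc_image_Icc hf hi h0.le h1 le_rfl,
    by rw [← image_union, Icc_union_Icc_eq_Icc h0.le h1.le], ?_, ?_, ?_, ?_⟩
  · rw [← hi.image_inter (Icc_subset_Icc_right h1.le) (Icc_subset_Icc_left h0.le),
      Icc_inter_Icc_eq_singleton h0.le h1.le, image_singleton]
  · rintro _ ⟨s, ⟨hs0, hs1⟩, rfl⟩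
    refine hball ?_
    rw [Metric.mem_ball, Real.dist_eq, sub_zero, abs_of_nonneg hs0]
    have := min_le_left (ε / 2) (1 / 2)
    linarith
  · exact fun h ↦ h0.ne' (hi ⟨h0.le, h1.le⟩ ⟨le_rfl, zero_le_one⟩ h)
  · exact fun h ↦ h1.ne (hi ⟨h0.le, h1.le⟩ ⟨zero_le_one, le_rfl⟩ h)

end IsArc

theorem exists_norm_cx_le {K : Set (ℝ × ℝ)} (hK : Bornology.IsBounded K) :
    ∃ C > 0, ∀ z ∈ K, ‖cx z‖ ≤ C := by
  have h : Bornology.IsBounded (cx '' K) := (cx : (ℝ × ℝ) →L[ℝ] ℂ).lipschitz.isBounded_image hK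
  obtain ⟨C, hC, h⟩ := h.exists_pos_norm_le
  exact ⟨C, hC, fun z hz ↦ h _ (mem_image_of_mem _ hz)⟩

/-- A nowhere vanishing continuous function agreeing with a power near infinity: the exponent
vanishes. -/
theorem eq_zero_of_continuous_of_eq_zpow {h : ℝ × ℝ → ℂ} (hc : Continuous h) (h0 : ∀ z, h z ≠ 0)
    {K : Set (ℝ × ℝ)} (hK : Bornology.IsBounded K) {p : ℝ × ℝ} {m : ℤ}
    (hm : ∀ z ∉ K, h z = (cx z - cx p) ^ m) : m = 0 := by
  obtain ⟨C, hC, hCK⟩ := exists_norm_cx_le hK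
  obtain ⟨G, hG, hexp⟩ := exists_continuous_log hc h0
  set ρ : ℝ := C + ‖cx p‖ + 1 with hρ
  have hρ0 : 0 < ρ := by positivity
  have he : ∀ t : ℝ, cx (cx.symm (cx p + ρ * exp (t * I))) = cx p + ρ * exp (t * I) :=
    fun t ↦ cx.apply_symm_apply _
  have hout : ∀ t : ℝ, cx.symm (cx p + ρ * exp (t * I)) ∉ K := by
    intro t ht
    have h1 := hCK _ ht
    rw [he] at h1
    have h2 : ‖(ρ : ℂ) * exp (t * I)‖ = ρ := by
      rw [norm_mul, norm_exp_ofReal_mul_I, mul_one, norm_real, Real.norm_of_nonneg hρ0.le]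
    have h3 := norm_sub_le (cx p + ρ * exp (t * I)) (cx p)
    rw [add_sub_cancel_left, h2] at h3
    linarith
  have hk := eq_of_exp_eq_one (k := fun t : ℝ ↦ G (cx.symm (cx p + ρ * exp (t * I))) -
      m * (Real.log ρ + t * I)) (S := univ) isPreconnected_univ
    (Continuous.continuousOn (by fun_prop)) (by
      intro t _
      rw [exp_sub, hexp, hm _ (hout t), he, add_sub_cancel_left, exp_int_mul, exp_add,
        ← ofReal_exp, Real.exp_log hρ0]
      exact div_self (zpow_ne_zero _ (mul_ne_zero (by exact_mod_cast hρ0.ne') (exp_ne_zero _))))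
    (mem_univ 0) (mem_univ (2 * Real.pi))
  have hpi : (Real.pi : ℂ) ≠ 0 := by exact_mod_cast Real.pi_ne_zero
  simp only [ofReal_mul, ofReal_ofNat, exp_two_pi_mul_I, ofReal_zero, zero_mul, exp_zero] at hk
  have : (m : ℂ) * (2 * Real.pi * I) = 0 := by linear_combination hk
  rcases mul_eq_zero.1 this with h | h
  · exact_mod_cast h
  · exact absurd h (by simp [hpi])

theorem closure_connectedComponentIn_inter_subset {S : Set (ℝ × ℝ)} {p : ℝ × ℝ} (hp : p ∈ S) :
    closure (connectedComponentIn S p) ∩ S ⊆ connectedComponentIn S p := by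
  have hsub : connectedComponentIn S p ⊆ closure (connectedComponentIn S p) ∩ S :=
    subset_inter subset_closure (connectedComponentIn_subset _ _)
  exact (isPreconnected_connectedComponentIn.subset_closure hsub
    inter_subset_left).subset_connectedComponentIn (hsub (mem_connectedComponentIn hp))
    inter_subset_right

theorem eq_zero_of_zpow_eq {T : Set (ℝ × ℝ)} (hT : IsCompact T) {p q : ℝ × ℝ} (hp : p ∉ T)
    (hU : Bornology.IsBounded (connectedComponentIn Tᶜ p)) (hq : q ∉ connectedComponentIn Tᶜ p)
    (hqT : q ∉ T) {m k : ℤ} {F : ℝ × ℝ → ℂ} (hF : ContinuousOn F T)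
    (h : ∀ z ∈ T, exp (F z) = (cx z - cx p) ^ m / (cx z - cx q) ^ k) : m = 0 := by
  set U := connectedComponentIn Tᶜ p with hUdef
  have hUo : IsOpen U := hT.isClosed.isOpen_compl.connectedComponentIn
  have hpU : p ∈ U := mem_connectedComponentIn hp
  have hclU : ∀ z ∈ closure U, z ∈ U ∨ z ∈ T := fun z hz ↦ by
    by_cases hzT : z ∈ T
    · exact Or.inr hzT
    · exact Or.inl (closure_connectedComponentIn_inter_subset hp ⟨hz, hzT⟩)
  have hqU : ∀ z ∈ closure U, cx z - cx q ≠ 0 := fun z hz h0 ↦ by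
    have := cx.injective (sub_eq_zero.1 h0)
    subst this
    exact (hclU z hz).elim hq hqT
  have hpU' : ∀ z ∈ Uᶜ, cx z - cx p ≠ 0 := fun z hz h0 ↦ by
    rw [cx.injective (sub_eq_zero.1 h0)] at hz
    exact hz hpU
  obtain ⟨G, hG⟩ := ContinuousMap.exists_restrict_eq hT.isClosed
    (⟨_, continuousOn_iff_continuous_domRestrict.1 hF⟩ : C(T, ℂ))
  have hGF : ∀ z ∈ T, G z = F z := fun z hz ↦ congrArg (fun f : C(T, ℂ) ↦ f ⟨z, hz⟩) hG
  obtain ⟨H, hH, hHA, hHB⟩ := exists_glue (f := fun z ↦ (cx z - cx q) ^ k * exp (G z))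
    (g := fun z ↦ (cx z - cx p) ^ m)
    isClosed_closure hUo.isClosed_compl (A := closure U)
    (by
      refine ContinuousOn.mul (ContinuousOn.zpow₀ (by fun_prop) k fun z hz ↦ Or.inl (hqU z hz)) ?_
      exact Continuous.continuousOn (by fun_prop))
    (ContinuousOn.zpow₀ (by fun_prop) m fun z hz ↦ Or.inl (hpU' z hz))
    (by
      rintro z ⟨hz1, hz2⟩
      have hzT := (hclU z hz1).resolve_left hz2
      rw [hGF z hzT, h z hzT, mul_div_cancel₀ _ (zpow_ne_zero _ (hqU z hz1))])
  have huniv : closure U ∪ Uᶜ = univ :=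
    eq_univ_of_subset (union_subset_union_left _ subset_closure) (union_compl_self U)
  refine eq_zero_of_continuous_of_eq_zpow (h := H) ?_ ?_ hU (p := p) (fun z hz ↦ hHB z hz)
  · rwa [huniv, continuousOn_univ] at hH
  · intro z
    by_cases hz : z ∈ U
    · rw [hHA z (subset_closure hz)]
      exact mul_ne_zero (zpow_ne_zero _ (hqU z (subset_closure hz))) (exp_ne_zero _)
    · rw [hHB z hz]
      exact zpow_ne_zero _ (hpU' z hz)

theorem isPreconnected_norm_cx_gt {C : ℝ} (hC : 0 < C) :
    IsPreconnected {z : ℝ × ℝ | C < ‖cx z‖} := by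
  have h : {z : ℝ × ℝ | C < ‖cx z‖} = (fun w ↦ cx.symm (exp w)) '' {w : ℂ | Real.log C < w.re} := by
    ext z
    simp only [mem_ofPred_eq, mem_image]
    constructor
    · intro hz
      have h0 : cx z ≠ 0 := norm_pos_iff.1 (hC.trans hz)
      exact ⟨log (cx z), by rw [log_re]; exact Real.log_lt_log hC hz, by
        rw [exp_log h0, cx.symm_apply_apply]⟩
    · rintro ⟨w, hw, rfl⟩
      rw [cx.apply_symm_apply, norm_exp]
      exact (Real.log_lt_iff_lt_exp hC).1 hw
  rw [h]
  exact (convex_halfSpace_re_gt _).isPreconnected.image _ (by fun_prop)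

theorem isBounded_or_isBounded {T : Set (ℝ × ℝ)} (hT : IsCompact T) {p q : ℝ × ℝ}
    (hpq : connectedComponentIn Tᶜ p ≠ connectedComponentIn Tᶜ q) :
    Bornology.IsBounded (connectedComponentIn Tᶜ p) ∨
      Bornology.IsBounded (connectedComponentIn Tᶜ q) := by
  obtain ⟨C, hC, hCT⟩ := exists_norm_cx_le hT.isBounded
  have hb : Bornology.IsBounded {z : ℝ × ℝ | ‖cx z‖ ≤ C} := by
    have : {z : ℝ × ℝ | ‖cx z‖ ≤ C} = cx.symm '' Metric.closedBall 0 C := by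
      ext z
      simp only [mem_ofPred_eq, mem_image, mem_closedBall_zero_iff]
      exact ⟨fun h ↦ ⟨cx z, h, cx.symm_apply_apply z⟩, by
        rintro ⟨w, hw, rfl⟩; rwa [cx.apply_symm_apply]⟩
    rw [this]
    exact (cx.symm : ℂ →L[ℝ] (ℝ × ℝ)).lipschitz.isBounded_image Metric.isBounded_closedBall
  have key : ∀ p, ¬ Bornology.IsBounded (connectedComponentIn Tᶜ p) →
      {z : ℝ × ℝ | C < ‖cx z‖} ⊆ connectedComponentIn Tᶜ p := by
    intro p hp
    obtain ⟨x, hx, hxC⟩ : ∃ x ∈ connectedComponentIn Tᶜ p, C < ‖cx x‖ := by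
      by_contra! hcon
      exact hp (hb.subset fun x hx ↦ hcon x hx)
    rw [connectedComponentIn_eq hx]
    exact (isPreconnected_norm_cx_gt hC).subset_connectedComponentIn hxC
      fun z hz hzT ↦ absurd (hCT z hzT) (not_le.2 hz)
  by_contra! hcon
  have hz : C < ‖cx (cx.symm ((C + 1 : ℝ) : ℂ))‖ := by
    rw [cx.apply_symm_apply, norm_real, Real.norm_of_nonneg (by positivity)]
    linarith
  exact hpq ((connectedComponentIn_eq (key p hcon.1 hz)).trans
    (connectedComponentIn_eq (key q hcon.2 hz)).symm)

theorem HasLogs.isPreconnected_compl {T : Set (ℝ × ℝ)} (h : HasLogs T) (hT : IsCompact T) :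
    IsPreconnected Tᶜ := by
  have key : ∀ p ∉ T, ∀ q ∉ T, q ∉ connectedComponentIn Tᶜ p →
      ¬ Bornology.IsBounded (connectedComponentIn Tᶜ p) := by
    intro p hp q hq hqp hb
    obtain ⟨L, hL, hL2⟩ := h p hp
    exact one_ne_zero (eq_zero_of_zpow_eq hT hp hb hqp hq (m := 1) (k := 0) hL
      (fun z hz ↦ by rw [hL2 z hz]; simp))
  have hall : ∀ p ∉ T, ∀ q ∉ T, q ∈ connectedComponentIn Tᶜ p := by
    intro p hp q hq
    by_contra hqp
    have hne : connectedComponentIn Tᶜ p ≠ connectedComponentIn Tᶜ q := fun h ↦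
      hqp (h ▸ mem_connectedComponentIn hq)
    have hpq : p ∉ connectedComponentIn Tᶜ q := fun h ↦ hne (connectedComponentIn_eq h).symm
    exact (isBounded_or_isBounded hT hne).elim (key p hp q hq hqp) (key q hq p hp hpq)
  rcases Tᶜ.eq_empty_or_nonempty with he | ⟨p, hp⟩
  · rw [he]; exact isPreconnected_empty
  · rw [← Subset.antisymm (connectedComponentIn_subset _ _) fun q hq ↦ hall p hp q hq]
    exact isPreconnected_connectedComponentIn

/-- Three arcs forming a simple closed curve through `a`, `b`, `c`. -/
structure IsTri (A B C : Set (ℝ × ℝ)) (a b c : ℝ × ℝ) : Prop where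
  arc₁ : IsArc A a b
  arc₂ : IsArc B b c
  arc₃ : IsArc C c a
  inter₁ : A ∩ B = {b}
  inter₂ : B ∩ C = {c}
  inter₃ : C ∩ A = {a}

/-- The total variation of the logarithm along a closed curve made of three arcs. -/
noncomputable def wind (A B C : Set (ℝ × ℝ)) (a b c R : ℝ × ℝ) : ℂ :=
  dlog A a b R + dlog B b c R + dlog C c a R

namespace IsTri

variable {A B C : Set (ℝ × ℝ)} {a b c p q r : ℝ × ℝ}

theorem isCompact (h : IsTri A B C a b c) : IsCompact (A ∪ B ∪ C) :=
  (h.arc₁.isCompact.union h.arc₂.isCompact).union h.arc₃.isCompact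

theorem wind_eq_of_isArc (h : IsTri A B C a b c) {S : Set (ℝ × ℝ)} (hS : IsArc S p q)
    (hdis : Disjoint S (A ∪ B ∪ C)) : wind A B C a b c p = wind A B C a b c q := by
  have h1 := h.arc₁.dlog_reciprocity hS
    (hdis.mono_right (subset_union_left.trans subset_union_left)).symm
  have h2 := h.arc₂.dlog_reciprocity hS
    (hdis.mono_right (subset_union_right.trans subset_union_left)).symm
  have h3 := h.arc₃.dlog_reciprocity hS (hdis.mono_right subset_union_right).symm
  unfold wind
  linear_combination -h1 - h2 - h3

theorem wind_eq_of_segment (h : IsTri A B C a b c)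
    (hpq : Disjoint (segment ℝ p q) (A ∪ B ∪ C)) :
    wind A B C a b c p = wind A B C a b c q := by
  rcases eq_or_ne p q with rfl | hne
  · rfl
  · refine h.wind_eq_of_isArc (S := segment ℝ p q) ?_ hpq
    rw [segment_eq_image_lineMap]
    exact isArc_of_continuousOn (f := AffineMap.lineMap p q)
      AffineMap.lineMap_continuous.continuousOn
      (AffineMap.lineMap_injective ℝ hne).injOn rfl (by simp) (by simp)

theorem wind_eq_of_isPreconnected (h : IsTri A B C a b c) {S : Set (ℝ × ℝ)}
    (hS : IsPreconnected S) (hST : Disjoint S (A ∪ B ∪ C)) (hp : p ∈ S) (hq : q ∈ S) :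
    wind A B C a b c p = wind A B C a b c q := by
  refine hS.induction₂ (fun x y ↦ wind A B C a b c x = wind A B C a b c y) (fun x hx ↦ ?_)
    (fun _ _ _ _ _ _ h1 h2 ↦ h1.trans h2) (fun _ _ _ _ h ↦ h.symm) hp hq
  have hxT : (A ∪ B ∪ C)ᶜ ∈ 𝓝 x :=
    h.isCompact.isClosed.isOpen_compl.mem_nhds (disjoint_left.1 hST hx)
  obtain ⟨ε, hε, hball⟩ := Metric.mem_nhds_iff.1 hxT
  filter_upwards [mem_nhdsWithin_of_mem_nhds (Metric.ball_mem_nhds x hε)] with y hy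
  refine h.wind_eq_of_segment (disjoint_left.2 fun z hz ↦ ?_)
  exact hball ((convex_ball x ε).segment_subset (Metric.mem_ball_self hε) hy hz)

theorem exists_log_ratio (h : IsTri A B C a b c) (hp : p ∉ A ∪ B ∪ C) (hq : q ∉ A ∪ B ∪ C)
    {m k : ℤ} (hmk : m * wind A B C a b c p = k * wind A B C a b c q) :
    ∃ F : ℝ × ℝ → ℂ, ContinuousOn F (A ∪ B ∪ C) ∧
      ∀ z ∈ A ∪ B ∪ C, exp (F z) = (cx z - cx p) ^ m / (cx z - cx q) ^ k := by
  have key : ∀ {X x y}, IsArc X x y → X ⊆ A ∪ B ∪ C → ∃ F : ℝ × ℝ → ℂ, ContinuousOn F X ∧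
      (∀ z ∈ X, exp (F z) = (cx z - cx p) ^ m / (cx z - cx q) ^ k) ∧
      F y - F x = m * dlog X x y p - k * dlog X x y q := by
    intro X x y hX hsub
    obtain ⟨L, hL⟩ := hX.hasLogs p (fun h ↦ hp (hsub h))
    obtain ⟨M, hM⟩ := hX.hasLogs q (fun h ↦ hq (hsub h))
    refine ⟨fun z ↦ m * L z - k * M z,
      (continuousOn_const.mul hL.1).sub (continuousOn_const.mul hM.1), fun z hz ↦ ?_, ?_⟩
    · rw [exp_sub, exp_int_mul, exp_int_mul, hL.2 z hz, hM.2 z hz]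
    · rw [dlog_eq hX.isPreconnected hL hX.left_mem hX.right_mem,
        dlog_eq hX.isPreconnected hM hX.left_mem hX.right_mem]
      ring
  obtain ⟨F, hF, hF2, hF3⟩ := key h.arc₁ (subset_union_left.trans subset_union_left)
  obtain ⟨G, hG, hG2, hG3⟩ := key h.arc₂ (subset_union_right.trans subset_union_left)
  obtain ⟨H, hH, hH2, hH3⟩ := key h.arc₃ subset_union_right
  obtain ⟨N, hN, hN2, hNA, hNB⟩ :=
    exists_log_union h.arc₁.isClosed h.arc₂.isClosed h.inter₁ hF hF2 hG hG2
  have hNa := hNA a h.arc₁.left_mem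
  have hNc := hNB c h.arc₂.right_mem
  obtain ⟨P, hP, hPN, hPH⟩ := exists_glue (h.arc₁.isClosed.union h.arc₂.isClosed) h.arc₃.isClosed
    hN (g := fun z ↦ H z + (N c - H c)) (hH.add continuousOn_const) (by
      have hac : N a = H a + (N c - H c) := by
        rw [hNa, hNc]
        unfold wind at hmk
        linear_combination -hmk - hF3 - hG3 - hH3
      rintro x ⟨hx | hx, hxC⟩
      · have : x ∈ C ∩ A := ⟨hxC, hx⟩
        rw [h.inter₃] at this
        rw [mem_singleton_iff.1 this]
        exact hac
      · have : x ∈ B ∩ C := ⟨hx, hxC⟩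
        rw [h.inter₂] at this
        rw [mem_singleton_iff.1 this]
        ring)
  refine ⟨P, hP, ?_⟩
  rintro z (hz | hz)
  · rw [hPN z hz, hN2 z hz]
  · have hc1 := hN2 c (Or.inr h.arc₂.right_mem)
    have hne : exp (H c) ≠ 0 := exp_ne_zero _
    rw [hPH z hz, exp_add, exp_sub, hH2 z hz, hc1, ← hH2 c h.arc₃.left_mem, div_self hne, mul_one]

theorem exp_wind (h : IsTri A B C a b c) (hp : p ∉ A ∪ B ∪ C) : exp (wind A B C a b c p) = 1 := by
  have hA : p ∉ A := fun h ↦ hp (Or.inl (Or.inl h))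
  have hB : p ∉ B := fun h ↦ hp (Or.inl (Or.inr h))
  have hC : p ∉ C := fun h ↦ hp (Or.inr h)
  have hne : ∀ x ∈ A ∪ B ∪ C, cx x - cx p ≠ 0 := fun x hx h0 ↦
    hp (cx.injective (sub_eq_zero.1 h0) ▸ hx)
  have ha := hne a (Or.inl (Or.inl h.arc₁.left_mem))
  have hb := hne b (Or.inl (Or.inl h.arc₁.right_mem))
  have hc := hne c (Or.inr h.arc₃.left_mem)
  rw [wind, exp_add, exp_add, h.arc₁.exp_dlog hA, h.arc₂.exp_dlog hB, h.arc₃.exp_dlog hC]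
  field_simp

theorem connectedComponentIn_eq_of_isBounded (h : IsTri A B C a b c) (hp : p ∉ A ∪ B ∪ C)
    (hq : q ∉ A ∪ B ∪ C)
    (hbp : Bornology.IsBounded (connectedComponentIn (A ∪ B ∪ C)ᶜ p))
    (hbq : Bornology.IsBounded (connectedComponentIn (A ∪ B ∪ C)ᶜ q)) :
    connectedComponentIn (A ∪ B ∪ C)ᶜ p = connectedComponentIn (A ∪ B ∪ C)ᶜ q := by
  by_contra hne
  have h1 : q ∉ connectedComponentIn (A ∪ B ∪ C)ᶜ p := fun h ↦ hne (connectedComponentIn_eq h)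
  have h2 : p ∉ connectedComponentIn (A ∪ B ∪ C)ᶜ q := fun h ↦
    hne (connectedComponentIn_eq h).symm
  obtain ⟨j, hj⟩ := exp_eq_one_iff.1 (h.exp_wind hp)
  obtain ⟨l, hl⟩ := exp_eq_one_iff.1 (h.exp_wind hq)
  obtain ⟨F, hF, hF2⟩ := h.exists_log_ratio hp hq (m := l) (k := j) (by rw [hj, hl]; ring)
  obtain ⟨G, hG, hG2⟩ := h.exists_log_ratio hq hp (m := j) (k := l) (by rw [hj, hl]; ring)
  obtain ⟨H, hH, hH2⟩ := h.exists_log_ratio hp hq (m := 1) (k := 1) (by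
    rw [hj, hl, eq_zero_of_zpow_eq h.isCompact hp hbp h1 hq hF hF2,
      eq_zero_of_zpow_eq h.isCompact hq hbq h2 hp hG hG2])
  exact one_ne_zero (eq_zero_of_zpow_eq h.isCompact hp hbp h1 hq hH hH2)

theorem connectedComponentIn_eq_of_wind_eq (h : IsTri A B C a b c) (hp : p ∉ A ∪ B ∪ C)
    (hq : q ∉ A ∪ B ∪ C) (hpq : wind A B C a b c p = wind A B C a b c q) :
    connectedComponentIn (A ∪ B ∪ C)ᶜ p = connectedComponentIn (A ∪ B ∪ C)ᶜ q := by
  by_contra hne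
  have h1 : q ∉ connectedComponentIn (A ∪ B ∪ C)ᶜ p := fun h ↦ hne (connectedComponentIn_eq h)
  have h2 : p ∉ connectedComponentIn (A ∪ B ∪ C)ᶜ q := fun h ↦
    hne (connectedComponentIn_eq h).symm
  obtain ⟨F, hF, hF2⟩ := h.exists_log_ratio hp hq (m := 1) (k := 1) (by rw [hpq])
  obtain ⟨G, hG, hG2⟩ := h.exists_log_ratio hq hp (m := 1) (k := 1) (by rw [hpq])
  rcases isBounded_or_isBounded h.isCompact hne with hb | hb
  · exact one_ne_zero (eq_zero_of_zpow_eq h.isCompact hp hb h1 hq hF hF2)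
  · exact one_ne_zero (eq_zero_of_zpow_eq h.isCompact hq hb h2 hp hG hG2)

theorem wind_eq_of_mem (h : IsTri A B C a b c)
    (hq : q ∈ connectedComponentIn (A ∪ B ∪ C)ᶜ p) :
    wind A B C a b c q = wind A B C a b c p := by
  have hp : p ∈ (A ∪ B ∪ C)ᶜ := connectedComponentIn_nonempty_iff.1 ⟨q, hq⟩
  exact h.wind_eq_of_isPreconnected isPreconnected_connectedComponentIn
    (disjoint_left.2 fun z hz ↦ connectedComponentIn_subset _ _ hz) hq
    (mem_connectedComponentIn hp)

/-- A closed curve made of three arcs has at most two winding values. -/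
theorem wind_two_valued (h : IsTri A B C a b c) (hp : p ∉ A ∪ B ∪ C) (hq : q ∉ A ∪ B ∪ C)
    (hr : r ∉ A ∪ B ∪ C) :
    wind A B C a b c p = wind A B C a b c q ∨ wind A B C a b c q = wind A B C a b c r ∨
      wind A B C a b c p = wind A B C a b c r := by
  have key : ∀ {x y}, x ∉ A ∪ B ∪ C → connectedComponentIn (A ∪ B ∪ C)ᶜ x =
      connectedComponentIn (A ∪ B ∪ C)ᶜ y → wind A B C a b c x = wind A B C a b c y :=
    fun hx hxy ↦ h.wind_eq_of_mem (hxy ▸ mem_connectedComponentIn hx)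
  by_contra! hcon
  have n1 := mt (key hp) hcon.1
  have n2 := mt (key hq) hcon.2.1
  have n3 := mt (key hp) hcon.2.2
  have e1 := mt fun hb : _ ∧ _ ↦ h.connectedComponentIn_eq_of_isBounded hp hq hb.1 hb.2
  have e2 := mt fun hb : _ ∧ _ ↦ h.connectedComponentIn_eq_of_isBounded hq hr hb.1 hb.2
  have e3 := mt fun hb : _ ∧ _ ↦ h.connectedComponentIn_eq_of_isBounded hp hr hb.1 hb.2
  have b1 := isBounded_or_isBounded h.isCompact n1
  have b2 := isBounded_or_isBounded h.isCompact n2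
  have b3 := isBounded_or_isBounded h.isCompact n3
  tauto

/-- Every component of the complement accumulates at every interior point of the first arc. -/
theorem mem_closure_connectedComponentIn (h : IsTri A B C a b c) (hp : p ∉ A ∪ B ∪ C)
    (hr : r ∈ A) (hra : r ≠ a) (hrb : r ≠ b) :
    r ∈ closure (connectedComponentIn (A ∪ B ∪ C)ᶜ p) := by
  set K := connectedComponentIn (A ∪ B ∪ C)ᶜ p with hK
  by_contra hrK
  obtain ⟨A₁, A₂, hA₁, hA₂, hAu, hAi⟩ := h.arc₁.split hr hra hrb
  have hV : (closure K)ᶜ ∈ 𝓝 r := isClosed_closure.isOpen_compl.mem_nhds hrK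
  obtain ⟨r₁, S₁, P₁, hS₁, hP₁, hu₁, hi₁, hV₁, hr₁, hr₁'⟩ := hA₁.symm.exists_initial hV
  obtain ⟨r₂, S₂, P₂, hS₂, hP₂, hu₂, hi₂, hV₂, hr₂, hr₂'⟩ := hA₂.exists_initial hV
  have hP₁A : P₁ ⊆ A₁ := hu₁ ▸ subset_union_right
  have hP₂A : P₂ ⊆ A₂ := hu₂ ▸ subset_union_right
  have hA₁A : A₁ ⊆ A := hAu ▸ subset_union_left
  have hA₂A : A₂ ⊆ A := hAu ▸ subset_union_right
  have hrP₁ : r ∉ P₁ := fun hh ↦ hr₁ (by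
    have : r ∈ S₁ ∩ P₁ := ⟨hS₁.left_mem, hh⟩
    rw [hi₁] at this; exact this.symm)
  have hrP₂ : r ∉ P₂ := fun hh ↦ hr₂ (by
    have : r ∈ S₂ ∩ P₂ := ⟨hS₂.left_mem, hh⟩
    rw [hi₂] at this; exact this.symm)
  have hPP : Disjoint P₁ P₂ := disjoint_left.2 fun x hx hx2 ↦ hrP₁ (by
    have : x ∈ A₁ ∩ A₂ := ⟨hP₁A hx, hP₂A hx2⟩
    rw [hAi] at this; rwa [← mem_singleton_iff.1 this])
  have hab := h.arc₁.ne
  have hLogs : HasLogs (P₂ ∪ B ∪ C ∪ P₁) := by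
    have i1 : P₂ ∩ B = {b} := Subset.antisymm
      (fun x hx ↦ h.inter₁ ▸ ⟨hA₂A (hP₂A hx.1), hx.2⟩)
      (singleton_subset_iff.2 ⟨hP₂.right_mem, h.arc₂.left_mem⟩)
    have ha₂ : a ∉ A₂ := fun ha ↦ hra (by
      have : a ∈ A₁ ∩ A₂ := ⟨hA₁.left_mem, ha⟩
      rw [hAi] at this; exact this.symm)
    have hb₁ : b ∉ A₁ := fun hb ↦ hrb (by
      have : b ∈ A₁ ∩ A₂ := ⟨hb, hA₂.right_mem⟩
      rw [hAi] at this; exact this.symm)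
    have i2 : (P₂ ∪ B) ∩ C = {c} := by
      rw [union_inter_distrib_right, h.inter₂]
      refine union_eq_right.2 fun x hx ↦ ?_
      have : x ∈ C ∩ A := ⟨hx.2, hA₂A (hP₂A hx.1)⟩
      rw [h.inter₃] at this
      rw [mem_singleton_iff.1 this] at hx
      exact absurd (hP₂A hx.1) ha₂
    have i3 : (P₂ ∪ B ∪ C) ∩ P₁ = {a} := by
      refine Subset.antisymm ?_ (singleton_subset_iff.2 ⟨Or.inr h.arc₃.right_mem, hP₁.right_mem⟩)
      rintro x ⟨(hx | hx) | hx, hx1⟩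
      · exact absurd hx (disjoint_left.1 hPP hx1)
      · have : x ∈ A ∩ B := ⟨hA₁A (hP₁A hx1), hx⟩
        rw [h.inter₁] at this
        rw [mem_singleton_iff.1 this] at hx1
        exact absurd (hP₁A hx1) hb₁
      · exact h.inter₃ ▸ ⟨hx, hA₁A (hP₁A hx1)⟩
    have c1 := hP₂.isClosed.union h.arc₂.isClosed
    exact HasLogs.union (c1.union h.arc₃.isClosed) hP₁.isClosed i3
      (HasLogs.union c1 h.arc₃.isClosed i2
        (HasLogs.union hP₂.isClosed h.arc₂.isClosed i1 hP₂.hasLogs h.arc₂.hasLogs)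
        h.arc₃.hasLogs) hP₁.hasLogs
  have hcomp := hLogs.isPreconnected_compl
    (((hP₂.isCompact.union h.arc₂.isCompact).union h.arc₃.isCompact).union hP₁.isCompact)
  have hTsub : P₂ ∪ B ∪ C ∪ P₁ ⊆ A ∪ B ∪ C := by
    rintro x (((hx | hx) | hx) | hx)
    · exact Or.inl (Or.inl (hA₂A (hP₂A hx)))
    · exact Or.inl (Or.inr hx)
    · exact Or.inr hx
    · exact Or.inl (Or.inl (hA₁A (hP₁A hx)))
  have hrT : r ∉ P₂ ∪ B ∪ C ∪ P₁ := by
    rintro (((hx | hx) | hx) | hx)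
    · exact hrP₂ hx
    · exact hrb (by have : r ∈ A ∩ B := ⟨hr, hx⟩
                    rw [h.inter₁] at this; exact this)
    · exact hra (by have : r ∈ C ∩ A := ⟨hx, hr⟩
                    rw [h.inter₃] at this; exact this)
    · exact hrP₁ hx
  refine hrK (subset_closure (hcomp.subset_of_closure_inter_subset (u := K)
    h.isCompact.isClosed.isOpen_compl.connectedComponentIn
    ⟨p, fun hh ↦ hp (hTsub hh), mem_connectedComponentIn hp⟩ ?_ hrT))
  rintro x ⟨hxK, hxT⟩
  by_cases hx : x ∈ A ∪ B ∪ C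
  · exfalso
    rcases hx with (hx | hx) | hx
    · rw [← hAu, ← hu₁, ← hu₂] at hx
      rcases hx with (hx | hx) | (hx | hx)
      · exact hV₁ hx hxK
      · exact hxT (Or.inr hx)
      · exact hV₂ hx hxK
      · exact hxT (Or.inl (Or.inl (Or.inl hx)))
    · exact hxT (Or.inl (Or.inl (Or.inr hx)))
    · exact hxT (Or.inl (Or.inr hx))
  · exact closure_connectedComponentIn_inter_subset hp ⟨hxK, hx⟩

end IsTri

/-- Interaction of two arcs through the variations of the logarithm: it vanishes for disjoint
arcs. -/
noncomputable def arcCross (A : Set (ℝ × ℝ)) (a b : ℝ × ℝ) (B : Set (ℝ × ℝ)) (c d : ℝ × ℝ) : ℂ :=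
  dlog A a b d - dlog A a b c - dlog B c d b + dlog B c d a

theorem arcCross_eq_zero {A B : Set (ℝ × ℝ)} {a b c d : ℝ × ℝ} (hA : IsArc A a b)
    (hB : IsArc B c d) (h : Disjoint A B) : arcCross A a b B c d = 0 := by
  have := hA.dlog_reciprocity hB h
  unfold arcCross
  linear_combination this

/-- An arc passing through `p`, cut into an initial piece, a piece around `p` inside a given
neighbourhood, and a final piece. -/
structure IsCut (A : Set (ℝ × ℝ)) (a b p : ℝ × ℝ) (P V Q : Set (ℝ × ℝ)) (q r : ℝ × ℝ) : Prop where
  arcP : IsArc P a q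
  arcV : IsArc V q r
  arcQ : IsArc Q r b
  subP : P ⊆ A
  subV : V ⊆ A
  subQ : Q ⊆ A
  a_notMem_V : a ∉ V
  b_notMem_V : b ∉ V
  a_notMem_Q : a ∉ Q
  b_notMem_P : b ∉ P
  p_notMem_P : p ∉ P
  p_notMem_Q : p ∉ Q
  disjoint : Disjoint P Q

theorem IsCut.symm {A : Set (ℝ × ℝ)} {a b p : ℝ × ℝ} {P V Q : Set (ℝ × ℝ)} {q r : ℝ × ℝ}
    (h : IsCut A a b p P V Q q r) : IsCut A b a p Q V P r q :=
  ⟨h.arcQ.symm, h.arcV.symm, h.arcP.symm, h.subQ, h.subV, h.subP, h.b_notMem_V, h.a_notMem_V,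
    h.b_notMem_P, h.a_notMem_Q, h.p_notMem_Q, h.p_notMem_P, h.disjoint.symm⟩

theorem IsArc.exists_isCut {A : Set (ℝ × ℝ)} {a b p : ℝ × ℝ} (hA : IsArc A a b) (hp : p ∈ A)
    (hpa : p ≠ a) (hpb : p ≠ b) {U : Set (ℝ × ℝ)} (hU : U ∈ 𝓝 p) :
    ∃ P V Q q r, IsCut A a b p P V Q q r ∧ V ⊆ U ∧ ∃ S, IsArc S p q ∧ S ⊆ V := by
  obtain ⟨f, hf, hfA, hi, rfl, rfl, rfl⟩ := id hA
  obtain ⟨t, ⟨ht0, ht1⟩, rfl⟩ := hp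
  have h0 : 0 < t := lt_of_le_of_ne ht0 (fun h ↦ hpa (by rw [h]))
  have h1 : t < 1 := lt_of_le_of_ne ht1 (fun h ↦ hpb (by rw [h]))
  obtain ⟨ε, hε, hball⟩ := Metric.mem_nhds_iff.1 (hf.continuousAt.preimage_mem_nhds hU)
  obtain ⟨t₁, ht₁, ht₁'⟩ := exists_between (max_lt h0 (show t - ε < t by linarith))
  obtain ⟨t₂, ht₂, ht₂'⟩ := exists_between (lt_min h1 (show t < t + ε by linarith))
  obtain ⟨k1, k2⟩ := max_lt_iff.1 ht₁
  obtain ⟨k3, k4⟩ := lt_min_iff.1 ht₂'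
  have hmem : ∀ s c d : ℝ, 0 ≤ c → d ≤ 1 → s ∈ Icc (0:ℝ) 1 → f s ∈ f '' Icc c d → s ∈ Icc c d := by
    rintro s c d hc hd hs ⟨s', hs', he⟩
    rwa [← hi ⟨hc.trans hs'.1, hs'.2.trans hd⟩ hs he]
  have z0 : (0:ℝ) ∈ Icc (0:ℝ) 1 := ⟨le_rfl, zero_le_one⟩
  have z1 : (1:ℝ) ∈ Icc (0:ℝ) 1 := ⟨zero_le_one, le_rfl⟩
  have zt : t ∈ Icc (0:ℝ) 1 := ⟨ht0, ht1⟩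
  refine ⟨f '' Icc 0 t₁, f '' Icc t₁ t₂, f '' Icc t₂ 1, f t₁, f t₂, ?_, ?_, f '' Icc t₁ t,
    (isArc_image_Icc hf hi k1.le ht₁' ht1).symm, image_mono (Icc_subset_Icc le_rfl ht₂.le)⟩
  · constructor
    · exact isArc_image_Icc hf hi le_rfl k1 (by linarith)
    · exact isArc_image_Icc hf hi k1.le (by linarith) k3.le
    · exact isArc_image_Icc hf hi (by linarith) k3 le_rfl
    · exact image_mono (Icc_subset_Icc le_rfl (by linarith))
    · exact image_mono (Icc_subset_Icc k1.le k3.le)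
    · exact image_mono (Icc_subset_Icc (by linarith) le_rfl)
    · exact fun h ↦ by have := (hmem 0 _ _ k1.le k3.le z0 h).1; linarith
    · exact fun h ↦ by have := (hmem 1 _ _ k1.le k3.le z1 h).2; linarith
    · exact fun h ↦ by have := (hmem 0 _ _ (by linarith) le_rfl z0 h).1; linarith
    · exact fun h ↦ by have := (hmem 1 _ _ le_rfl (by linarith) z1 h).2; linarith
    · exact fun h ↦ by have := (hmem t _ _ le_rfl (by linarith) zt h).2; linarith
    · exact fun h ↦ by have := (hmem t _ _ (by linarith) le_rfl zt h).1; linarith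
    · refine disjoint_left.2 ?_
      rintro _ ⟨s, hs, rfl⟩ h
      have := (hmem s _ _ (by linarith) le_rfl ⟨hs.1, by linarith [hs.2]⟩ h).1
      linarith [hs.2]
  · rintro _ ⟨s, ⟨hs0, hs1⟩, rfl⟩
    refine hball ?_
    rw [Metric.mem_ball, Real.dist_eq, abs_lt]
    constructor <;> linarith

theorem IsCut.arcCross_eq {A : Set (ℝ × ℝ)} {a b p : ℝ × ℝ} {P V Q : Set (ℝ × ℝ)} {q r : ℝ × ℝ}
    (hA : IsArc A a b) (h : IsCut A a b p P V Q q r) (B : Set (ℝ × ℝ)) {c d : ℝ × ℝ}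
    (hc : c ∉ A) (hd : d ∉ A) :
    arcCross B c d A a b = arcCross B c d P a q + arcCross B c d V q r + arcCross B c d Q r b := by
  have key : ∀ R ∉ A, dlog A a b R = dlog P a q R + dlog V q r R + dlog Q r b R := by
    intro R hR
    obtain ⟨L, hL⟩ := hA.hasLogs R hR
    rw [dlog_eq hA.isPreconnected hL hA.left_mem hA.right_mem,
      dlog_eq h.arcP.isPreconnected (hL.mono h.subP) h.arcP.left_mem h.arcP.right_mem,
      dlog_eq h.arcV.isPreconnected (hL.mono h.subV) h.arcV.left_mem h.arcV.right_mem,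
      dlog_eq h.arcQ.isPreconnected (hL.mono h.subQ) h.arcQ.left_mem h.arcQ.right_mem]
    ring
  unfold arcCross
  rw [key c hc, key d hd]
  ring

theorem wind_sub_wind (A B C P : Set (ℝ × ℝ)) (a b c x y : ℝ × ℝ) :
    wind A B C a b c y - wind A B C a b c x =
      arcCross A a b P x y + arcCross B b c P x y + arcCross C c a P x y := by
  unfold wind arcCross
  ring

end PlaneCurve

namespace SimpleDrawing

open PlaneCurve Topology

variable {n : ℕ} (D : SimpleDrawing n)

/-- Four pairwise distinct vertices. -/
structure Four {V : Type*} (a b c d : V) : Prop where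
  ab : a ≠ b
  ac : a ≠ c
  ad : a ≠ d
  bc : b ≠ c
  bd : b ≠ d
  cd : c ≠ d

/-- Variation of the logarithm of the displacement from `R` along the edge from `a` to `b`. -/
noncomputable def turn (a b : Fin n) (R : ℝ × ℝ) : ℂ :=
  dlog (D.arc a b) (D.vert a) (D.vert b) R

/-- The winding of the triangle `a b c` around `R`. -/
noncomputable def windAt (a b c : Fin n) (R : ℝ × ℝ) : ℂ :=
  D.turn a b R + D.turn b c R + D.turn c a R

/-- The algebraic crossing number (up to a factor) of the edges `a b` and `c d`. -/
noncomputable def crossNum (a b c d : Fin n) : ℂ :=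
  D.turn a b (D.vert d) - D.turn a b (D.vert c) - D.turn c d (D.vert b) + D.turn c d (D.vert a)

/-- The winding of the triangle `a b c` around the points of the edge `a d` close to `a`. -/
noncomputable def germ (a b c d : Fin n) : ℂ :=
  D.windAt a b c (D.vert d) + D.crossNum a d b c

variable {D} {a b c d : Fin n} {p q r R : ℝ × ℝ}

theorem isArc (h : a ≠ b) : IsArc (D.arc a b) (D.vert a) (D.vert b) := by
  obtain ⟨f, hf, hi, hA, h0, h1⟩ := D.arc_simple a b h
  exact isArc_of_continuousOn hf hi hA h0 h1

theorem turn_symm (a b : Fin n) (R : ℝ × ℝ) : D.turn b a R = - D.turn a b R := by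
  rw [turn, D.arc_symm, dlog_antisymm, turn]

theorem windAt_rotate (a b c : Fin n) (R : ℝ × ℝ) : D.windAt b c a R = D.windAt a b c R := by
  unfold windAt; ring

theorem windAt_swap (a b c : Fin n) (R : ℝ × ℝ) : D.windAt a c b R = - D.windAt a b c R := by
  unfold windAt
  rw [turn_symm c a, turn_symm b c, turn_symm a b]
  ring

theorem crossNum_swap (a b c d : Fin n) : D.crossNum c d a b = - D.crossNum a b c d := by
  unfold crossNum; ring

theorem crossNum_symm_left (a b c d : Fin n) : D.crossNum b a c d = - D.crossNum a b c d := by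
  unfold crossNum; rw [turn_symm a b, turn_symm a b]; ring

theorem crossNum_symm_right (a b c d : Fin n) : D.crossNum a b d c = - D.crossNum a b c d := by
  unfold crossNum; rw [turn_symm c d, turn_symm c d]; ring

theorem germ_swap (a b c d : Fin n) : D.germ a c b d = - D.germ a b c d := by
  unfold germ; rw [windAt_swap, crossNum_symm_right]; ring

theorem vert_mem_left (h : a ≠ b) : D.vert a ∈ D.arc a b := (isArc h).left_mem

theorem vert_mem_right (h : a ≠ b) : D.vert b ∈ D.arc a b := (isArc h).right_mem

theorem vert_notMem (hab : a ≠ b) (hca : c ≠ a) (hcb : c ≠ b) : D.vert c ∉ D.arc a b := fun h ↦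
  (D.no_through_vertex a b c hab h).elim hca hcb

theorem arc_inter (hab : a ≠ b) (hbc : b ≠ c) (hac : a ≠ c) :
    D.arc a b ∩ D.arc b c = {D.vert b} := by
  have hne : s(a, b) ≠ s(b, c) := by
    intro h
    rcases Sym2.eq_iff.1 h with h | h
    · exact hab h.1
    · exact hac h.1
  have hb : D.vert b ∈ D.arc a b ∩ D.arc b c := ⟨vert_mem_right hab, vert_mem_left hbc⟩
  exact Subset.antisymm (fun x hx ↦ D.inter_subsingleton a b b c hab hbc hne hx hb)
    (singleton_subset_iff.2 hb)

/-- Two edges at a common vertex share only that vertex. -/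
theorem eq_vert_of_mem (hab : a ≠ b) (hac : a ≠ c) (hbc : b ≠ c) (h1 : p ∈ D.arc a b)
    (h2 : p ∈ D.arc a c) : p = D.vert a := by
  have := arc_inter (D := D) hab.symm hac hbc
  rw [D.arc_symm b a] at this
  have h3 : p ∈ D.arc a b ∩ D.arc a c := ⟨h1, h2⟩
  rwa [this] at h3

theorem isTri (hab : a ≠ b) (hbc : b ≠ c) (hac : a ≠ c) :
    IsTri (D.arc a b) (D.arc b c) (D.arc c a) (D.vert a) (D.vert b) (D.vert c) :=
  ⟨isArc hab, isArc hbc, isArc hac.symm, arc_inter hab hbc hac, arc_inter hbc hac.symm hab.symm,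
    arc_inter hac.symm hab hbc.symm⟩

variable (D) in
/-- The closed curve carrying the triangle `a b c`. -/
def tri (a b c : Fin n) : Set (ℝ × ℝ) := D.arc a b ∪ D.arc b c ∪ D.arc c a

theorem tri_rotate (a b c : Fin n) : D.tri b c a = D.tri a b c := by
  unfold tri; rw [union_comm, union_assoc]

theorem tri_swap (a b c : Fin n) : D.tri a c b = D.tri a b c := by
  unfold tri
  rw [D.arc_symm c b, D.arc_symm a c, D.arc_symm b a, union_comm, union_comm (D.arc c a),
    union_assoc]

theorem notMem_tri_of (h1 : p ∉ D.arc a b) (h2 : p ∉ D.arc b c) (h3 : p ∉ D.arc c a) :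
    p ∉ D.tri a b c := by
  rintro ((h | h) | h)
  exacts [h1 h, h2 h, h3 h]

theorem vert_notMem_tri (h : Four a b c d) : D.vert d ∉ D.tri a b c :=
  notMem_tri_of (vert_notMem h.ab h.ad.symm h.bd.symm) (vert_notMem h.bc h.bd.symm h.cd.symm)
    (vert_notMem h.ac.symm h.cd.symm h.ad.symm)

theorem triangle_eq_tri (a b c : Fin n) : D.triangle a b c = D.tri a b c := by
  unfold triangle tri; rw [D.arc_symm a c]

theorem crossNum_eq_zero (hab : a ≠ b) (hcd : c ≠ d) (h : Disjoint (D.arc a b) (D.arc c d)) :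
    D.crossNum a b c d = 0 := arcCross_eq_zero (isArc hab) (isArc hcd) h

theorem crossNum_eq_arcCross (a b c d : Fin n) : D.crossNum a b c d =
    arcCross (D.arc a b) (D.vert a) (D.vert b) (D.arc c d) (D.vert c) (D.vert d) := rfl

/-- Along an edge leaving `a` and avoiding the opposite side, the winding is constant. -/
theorem windAt_of_disjoint (h : Four a b c d) (hdis : Disjoint (D.arc a d) (D.arc b c))
    (hq : q ∈ D.arc a d) (hqa : q ≠ D.vert a) :
    q ∉ D.tri a b c ∧ D.windAt a b c q = D.windAt a b c (D.vert d) := by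
  have hT : ∀ x ∈ D.arc a d, x ≠ D.vert a → x ∉ D.tri a b c := fun x hx hxa ↦
    notMem_tri_of (fun h1 ↦ hxa (eq_vert_of_mem h.ad h.ab h.bd.symm hx h1))
      (disjoint_left.1 hdis hx)
      (fun h1 ↦ hxa (eq_vert_of_mem h.ad h.ac h.cd.symm hx (D.arc_symm c a ▸ h1)))
  refine ⟨hT q hq hqa, ?_⟩
  rcases eq_or_ne q (D.vert d) with rfl | hqd
  · rfl
  obtain ⟨A₁, A₂, h₁, h₂, hu, hi⟩ := (isArc h.ad).split hq hqa hqd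
  refine (isTri h.ab h.bc h.ac).wind_eq_of_isArc h₂ (disjoint_left.2 fun x hx ↦ ?_)
  refine hT x (hu ▸ Or.inr hx) ?_
  rintro rfl
  have : D.vert a ∈ A₁ ∩ A₂ := ⟨h₁.left_mem, hx⟩
  rw [hi] at this
  exact hqa this.symm

theorem germ_eq (h : D.crossNum a d b c = 0) : D.germ a b c d = D.windAt a b c (D.vert d) := by
  rw [germ, h, add_zero]

/-- There are points of the edge `a d` arbitrarily close to `a` with the winding `germ`. -/
theorem exists_windAt_eq_germ (h : Four a b c d) {U : Set (ℝ × ℝ)} (hU : U ∈ 𝓝 (D.vert a)) :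
    ∃ r ∈ D.arc a d ∩ U, r ≠ D.vert a ∧ r ≠ D.vert d ∧ r ∉ D.tri a b c ∧
      D.windAt a b c r = D.germ a b c d := by
  have hbc : (D.arc b c)ᶜ ∈ 𝓝 (D.vert a) :=
    (isArc h.bc).isClosed.isOpen_compl.mem_nhds (vert_notMem h.bc h.ab h.ac)
  obtain ⟨r, A₁, A₂, h₁, h₂, hu, hi, hsub, hra, hrd⟩ :=
    (isArc h.ad).exists_initial (Filter.inter_mem hU hbc)
  have s₁ : A₁ ⊆ D.arc a d := hu ▸ subset_union_left
  have s₂ : A₂ ⊆ D.arc a d := hu ▸ subset_union_right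
  have hr := s₁ h₁.right_mem
  have ha₂ : D.vert a ∉ A₂ := fun hh ↦ hra (by
    have : D.vert a ∈ A₁ ∩ A₂ := ⟨h₁.left_mem, hh⟩
    rw [hi] at this
    exact this.symm)
  have d1 : Disjoint (D.arc a b) A₂ := disjoint_left.2 fun x hx hx2 ↦
    ha₂ (eq_vert_of_mem h.ad h.ab h.bd.symm (s₂ hx2) hx ▸ hx2)
  have d3 : Disjoint (D.arc c a) A₂ := disjoint_left.2 fun x hx hx2 ↦
    ha₂ (eq_vert_of_mem h.ad h.ac h.cd.symm (s₂ hx2) (D.arc_symm c a ▸ hx) ▸ hx2)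
  have d2 : Disjoint (D.arc b c) A₁ := disjoint_left.2 fun x hx hx2 ↦ (hsub hx2).2 hx
  refine ⟨r, ⟨hr, (hsub h₁.right_mem).1⟩, hra, hrd, notMem_tri_of
    (fun hh ↦ disjoint_left.1 d1 hh h₂.left_mem) (hsub h₁.right_mem).2
    (fun hh ↦ disjoint_left.1 d3 hh h₂.left_mem), ?_⟩
  have e1 := (isArc h.ab).dlog_reciprocity h₂ d1
  have e2 := (isArc h.bc).dlog_reciprocity h₁ d2
  have e3 := (isArc h.ac.symm).dlog_reciprocity h₂ d3
  have f1 := (isArc h.ad).dlog_add h₁ h₂ s₁ s₂ (vert_notMem h.ad h.ab.symm h.bd)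
  have f2 := (isArc h.ad).dlog_add h₁ h₂ s₁ s₂ (vert_notMem h.ad h.ac.symm h.cd)
  unfold germ windAt crossNum turn
  linear_combination -e1 + e2 - e3 + f1 - f2

theorem windAt_two_valued (hab : a ≠ b) (hbc : b ≠ c) (hac : a ≠ c) (hp : p ∉ D.tri a b c)
    (hq : q ∉ D.tri a b c) (hr : r ∉ D.tri a b c) :
    D.windAt a b c p = D.windAt a b c q ∨ D.windAt a b c q = D.windAt a b c r ∨
      D.windAt a b c p = D.windAt a b c r := (isTri hab hbc hac).wind_two_valued hp hq hr

theorem crossNum_eq_or (h : Four a b c d) (h1 : D.crossNum a d b c ≠ 0)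
    (h2 : D.crossNum b d c a ≠ 0) : D.crossNum a d b c = D.crossNum b d c a := by
  obtain ⟨r, -, -, -, hr, hr2⟩ := exists_windAt_eq_germ (D := D) h Filter.univ_mem
  obtain ⟨s, -, -, -, hs, hs2⟩ := exists_windAt_eq_germ (D := D)
    (⟨h.bc, h.ab.symm, h.bd, h.ac.symm, h.cd, h.ad⟩ : Four b c a d) Filter.univ_mem
  rw [tri_rotate] at hs
  rw [germ, windAt_rotate a b c, windAt_rotate a b c] at hs2
  rw [germ] at hr2
  rcases windAt_two_valued h.ab h.bc h.ac (vert_notMem_tri h) hr hs with e | e | e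
  · exact absurd (by linear_combination hr2.symm.trans e.symm) h1
  · rw [hr2, hs2] at e
    exact add_left_cancel e
  · exact absurd (by linear_combination hs2.symm.trans e.symm) h2

/-- Among the three pairs of opposite edges on four vertices, at most one has a nonzero algebraic
crossing number. -/
theorem crossNum_exclusive (h : Four a b c d) (h1 : D.crossNum a b c d ≠ 0) :
    D.crossNum a c b d = 0 := by
  by_contra h2
  have s1 := crossNum_swap (D := D) a b c d
  have s2 : D.crossNum b d c a = D.crossNum a c b d := by
    rw [crossNum_symm_right b d a c, crossNum_swap, neg_neg]
  have s3 : D.crossNum d c a b = D.crossNum a b c d := by rw [crossNum_symm_left c d, s1, neg_neg]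
  have e1 := crossNum_eq_or (D := D)
    (⟨h.bc, h.ab.symm, h.bd, h.ac.symm, h.cd, h.ad⟩ : Four b c a d)
    (s2 ▸ h2) (s1 ▸ neg_ne_zero.2 h1)
  have e2 := crossNum_eq_or (D := D)
    (⟨h.ad.symm, h.bd.symm, h.cd.symm, h.ab, h.ac, h.bc⟩ : Four d a b c)
    (s3 ▸ h1) h2
  rw [s2, s1] at e1
  rw [s3] at e2
  exact h1 (self_eq_neg.1 (e2.trans e1))

end SimpleDrawing

namespace SimpleDrawing

open PlaneCurve Topology

variable {n : ℕ} {D : SimpleDrawing n} {s a b c d i j : Fin n} {k : ℂ} {p q r : ℝ × ℝ}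

variable (D) in
/-- The vertex `i` lies on the triangle `a b c` or has winding `k` with respect to it. -/
def InSide (a b c : Fin n) (k : ℂ) (i : Fin n) : Prop :=
  i = a ∨ i = b ∨ i = c ∨ D.windAt a b c (D.vert i) = k

variable (D) in
/-- The number `k` is the winding of the triangle `a b c` around the points of a convex side. -/
structure IsConvexValue (a b c : Fin n) (k : ℂ) : Prop where
  exists_point : ∃ p, p ∉ D.tri a b c ∧ D.windAt a b c p = k
  windAt_eq : ∀ i j, i ≠ j → D.InSide a b c k i → D.InSide a b c k j → ∀ q ∈ D.arc i j,
    q ∉ D.tri a b c → D.windAt a b c q = k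

theorem mem_closure_component_of_vert (hab : a ≠ b) (hbc : b ≠ c) (hac : a ≠ c)
    (hp : p ∉ D.tri a b c) : D.vert a ∈ closure (connectedComponentIn (D.tri a b c)ᶜ p) := by
  rw [← closure_closure]
  refine mem_closure_iff_nhds.2 fun U hU ↦ ?_
  obtain ⟨r, A₁, A₂, h₁, -, hu, -, hsub, hra, hrb⟩ := (isArc (D := D) hab).exists_initial hU
  exact ⟨r, hsub h₁.right_mem, (isTri hab hbc hac).mem_closure_connectedComponentIn hp
    (hu ▸ Or.inl h₁.right_mem) hra hrb⟩

theorem Convex.exists_isConvexValue (hD : D.Convex) (hab : a ≠ b) (hbc : b ≠ c) (hac : a ≠ c) :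
    ∃ k, D.IsConvexValue a b c k := by
  obtain ⟨S, ⟨p, hp, rfl⟩, hS⟩ := hD a b c hab hbc hac
  rw [triangle_eq_tri] at hp hS
  refine ⟨D.windAt a b c p, ⟨p, hp, rfl⟩, ?_⟩
  have key : ∀ i, D.InSide a b c (D.windAt a b c p) i →
      D.vert i ∈ closure (connectedComponentIn (D.tri a b c)ᶜ p) := by
    intro i hi
    by_cases hia : i = a
    · rw [hia]
      exact mem_closure_component_of_vert hab hbc hac hp
    by_cases hib : i = b
    · have := mem_closure_component_of_vert (D := D) (p := p) hbc hac.symm hab.symm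
        (tri_rotate (D := D) a b c ▸ hp)
      rwa [hib, ← tri_rotate a b c]
    by_cases hic : i = c
    · have := mem_closure_component_of_vert (D := D) (p := p) hac.symm hab hbc.symm
        (tri_rotate (D := D) c a b ▸ hp)
      rwa [hic, tri_rotate c a b]
    have hi' : D.windAt a b c (D.vert i) = D.windAt a b c p := by
      rcases hi with h | h | h | h
      exacts [absurd h hia, absurd h hib, absurd h hic, h]
    have hn : D.vert i ∉ D.tri a b c :=
      vert_notMem_tri ⟨hab, hac, Ne.symm hia, hbc, Ne.symm hib, Ne.symm hic⟩
    refine subset_closure ?_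
    have := (isTri (D := D) hab hbc hac).connectedComponentIn_eq_of_wind_eq hp hn hi'.symm
    exact this ▸ mem_connectedComponentIn hn
  intro i j hij hi hj q hq hqT
  exact (isTri hab hbc hac).wind_eq_of_mem
    (closure_connectedComponentIn_inter_subset hp ⟨hS i j hij (key i hi) (key j hj) hq, hqT⟩)

theorem IsConvexValue.rotate (h : D.IsConvexValue a b c k) : D.IsConvexValue b c a k := by
  have e : ∀ i, D.InSide b c a k i → D.InSide a b c k i := by
    unfold InSide
    intro i
    rw [windAt_rotate a b c]
    tauto
  refine ⟨?_, fun i j hij hi hj q ↦ ?_⟩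
  · rw [tri_rotate]
    simpa only [windAt_rotate a b c] using h.exists_point
  · rw [tri_rotate, windAt_rotate a b c]
    exact h.windAt_eq i j hij (e i hi) (e j hj) q

theorem IsConvexValue.swap (h : D.IsConvexValue a b c k) : D.IsConvexValue a c b (-k) := by
  have e : ∀ i, D.InSide a c b (-k) i → D.InSide a b c k i := by
    unfold InSide
    intro i
    rw [windAt_swap a b c, neg_inj]
    tauto
  refine ⟨?_, fun i j hij hi hj q ↦ ?_⟩
  · rw [tri_swap]
    simpa only [windAt_swap a b c, neg_inj] using h.exists_point
  · rw [tri_swap, windAt_swap a b c, neg_inj]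
    exact h.windAt_eq i j hij (e i hi) (e j hj) q

theorem IsConvexValue.crossNum_eq_zero (hk : D.IsConvexValue a b c k) (h : Four a b c d)
    (hd : D.windAt a b c (D.vert d) = k) : D.crossNum a d b c = 0 := by
  obtain ⟨r, ⟨hr, -⟩, -, -, hrT, hr2⟩ := exists_windAt_eq_germ (D := D) h Filter.univ_mem
  have := hk.windAt_eq a d h.ad (Or.inl rfl) (Or.inr (Or.inr (Or.inr hd))) r hr hrT
  rw [hr2, germ, hd] at this
  exact add_eq_left.1 this

/-- In a crossing quadruple, the fourth vertex is not on the convex side of a triangle. -/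
theorem IsConvexValue.ne (hk : D.IsConvexValue s a b k) (h : Four s a b c)
    (hX : D.crossNum s c a b ≠ 0 ∨ D.crossNum s b a c ≠ 0 ∨ D.crossNum s a b c ≠ 0) :
    D.windAt s a b (D.vert c) ≠ k := by
  intro hc
  have h1 := hk.crossNum_eq_zero h hc
  have h2 := hk.rotate.crossNum_eq_zero (d := c)
    ⟨h.bc, h.ab.symm, h.bd, h.ac.symm, h.cd, h.ad⟩ (by rw [windAt_rotate, hc])
  have h3 := hk.rotate.rotate.crossNum_eq_zero (d := c)
    ⟨h.ac.symm, h.bc.symm, h.cd, h.ab, h.ad, h.bd⟩ (by rw [windAt_rotate, windAt_rotate, hc])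
  rw [crossNum_symm_right, crossNum_swap, neg_neg] at h2
  rw [crossNum_swap, neg_eq_zero] at h3
  tauto

theorem IsConvexValue.eq_of_ne (hk : D.IsConvexValue a b c k) (hab : a ≠ b) (hbc : b ≠ c)
    (hac : a ≠ c) (hp : p ∉ D.tri a b c) (hq : q ∉ D.tri a b c) (hpk : D.windAt a b c p ≠ k)
    (hqk : D.windAt a b c q ≠ k) : D.windAt a b c p = D.windAt a b c q := by
  obtain ⟨r, hr, rfl⟩ := hk.exists_point
  have := windAt_two_valued hab hbc hac hp hq hr
  tauto

theorem IsConvexValue.eq_or_eq (hk : D.IsConvexValue a b c k) (hab : a ≠ b) (hbc : b ≠ c)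
    (hac : a ≠ c) (hp : p ∉ D.tri a b c) (hq : q ∉ D.tri a b c)
    (hpq : D.windAt a b c p ≠ D.windAt a b c q) : D.windAt a b c p = k ∨ D.windAt a b c q = k := by
  obtain ⟨r, hr, rfl⟩ := hk.exists_point
  have := windAt_two_valued hab hbc hac hp hq hr
  tauto

theorem SeparatesAt.germ_ne (hb : Four s a c b) (hd : Four s a c d)
    (h : D.SeparatesAt s a c b d) : D.germ s a c b ≠ D.germ s a c d := by
  obtain ⟨p, q, hp, hq, hne, ⟨U, hU, hUp⟩, ⟨V, hV, hVq⟩⟩ := h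
  rw [triangle_eq_tri] at hp hq hne hUp hVq
  obtain ⟨x, hx, hxs, -, -, hxg⟩ := exists_windAt_eq_germ hb hU
  obtain ⟨y, hy, hys, -, -, hyg⟩ := exists_windAt_eq_germ hd hV
  have T := isTri (D := D) hb.ab hb.bc hb.ac
  have ex := T.wind_eq_of_mem (hUp ⟨hx, hxs⟩)
  have ey := T.wind_eq_of_mem (hVq ⟨hy, hys⟩)
  intro he
  refine hne (T.connectedComponentIn_eq_of_wind_eq hp hq ?_)
  rw [← ex, ← ey]
  exact hxg.trans (he.trans hyg.symm)

theorem germ_sub_germ (s a b c d : Fin n) :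
    D.germ s a b c - D.germ s a b d = -(D.germ s c d a - D.germ s c d b) := by
  unfold germ windAt crossNum
  rw [turn_symm s b, turn_symm s b, turn_symm s d, turn_symm s d]
  ring

theorem germ_eq_comm (h : D.germ s a b c = D.germ s a b d) :
    D.germ s c d a = D.germ s c d b := by
  have := germ_sub_germ (D := D) s a b c d
  rw [h, sub_self] at this
  exact sub_eq_zero.1 (neg_eq_zero.1 this.symm)

/-- If `c` and `d` are on the convex side of the triangle `s a b` and `x` is not, then `x` is
seen from the triangle `s c d` as the beginning of the edge `s a`. -/
theorem IsConvexValue.windAt_eq_germ (hk : D.IsConvexValue s a b k) {x : Fin n}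
    (hx : Four s a b x) (h : Four s c d a) (hc : D.InSide s a b k c) (hd : D.InSide s a b k d)
    (hxk : D.windAt s a b (D.vert x) ≠ k) : D.windAt s c d (D.vert x) = D.germ s c d a := by
  obtain ⟨r, ⟨hr, -⟩, hrs, hra, hrT, hrg⟩ := exists_windAt_eq_germ (D := D) h Filter.univ_mem
  have T := isTri (D := D) hx.ab hx.bc hx.ac
  have hxT := vert_notMem_tri (D := D) hx
  set K := connectedComponentIn (D.tri s a b)ᶜ (D.vert x) with hK
  have hxK : D.vert x ∈ K := mem_connectedComponentIn hxT
  have hrK : r ∈ closure K := T.mem_closure_connectedComponentIn hxT hr hrs hra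
  have hKr : IsPreconnected (insert r K) :=
    isPreconnected_connectedComponentIn.subset_closure (subset_insert _ _)
      (insert_subset hrK subset_closure)
  have hs : D.InSide s a b k s := Or.inl rfl
  have hdis : ∀ i j, i ≠ j → D.InSide s a b k i → D.InSide s a b k j → ∀ q ∈ K, q ∉ D.arc i j := by
    intro i j hij hi hj q hq hqa
    refine hxk ?_
    rw [← hk.windAt_eq i j hij hi hj q hqa (connectedComponentIn_subset _ _ hq)]
    exact (T.wind_eq_of_mem hq).symm
  rw [← hrg]
  refine (isTri h.ab h.bc h.ac).wind_eq_of_isPreconnected hKr (disjoint_left.2 fun q hq ↦ ?_)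
    (Or.inr hxK) (Or.inl rfl)
  rcases hq with rfl | hq
  · exact hrT
  · exact notMem_tri_of (hdis s c h.ab hs hc q hq) (hdis c d h.bc hc hd q hq)
      (hdis d s h.ac.symm hd hs q hq)

theorem IsConvexValue.windAt_eq_germ' (hk : D.IsConvexValue s a b k) {x : Fin n}
    (hx : Four s a b x) (h : Four s c d b) (hc : D.InSide s a b k c) (hd : D.InSide s a b k d)
    (hxk : D.windAt s a b (D.vert x) ≠ k) : D.windAt s c d (D.vert x) = D.germ s c d b := by
  have e : ∀ i, D.InSide s a b k i → D.InSide s b a (-k) i := by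
    unfold InSide
    intro i
    rw [windAt_swap s a b, neg_inj]
    tauto
  refine hk.swap.windAt_eq_germ ⟨hx.ac, hx.ab, hx.ad, hx.bc.symm, hx.cd, hx.bd⟩ h
    (e c hc) (e d hd) ?_
  rw [windAt_swap s a b, ne_eq, neg_inj]
  exact hxk

end SimpleDrawing

namespace SimpleDrawing

open PlaneCurve Topology

variable {n : ℕ} {D : SimpleDrawing n} {s z c e u y : Fin n} {k : ℂ} {p q r : ℝ × ℝ}

theorem exp_turn_sub (hbs : s ≠ z) (hcs : s ≠ c) (h : z ≠ c) :
    Complex.exp (D.turn s z (D.vert c) - D.turn s c (D.vert z)) =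
      -((cx (D.vert s) - cx (D.vert z)) / (cx (D.vert s) - cx (D.vert c))) := by
  have ne : ∀ {i j : Fin n}, i ≠ j → cx (D.vert i) - cx (D.vert j) ≠ 0 := fun hij h0 ↦
    hij (D.vert_inj (cx.injective (sub_eq_zero.1 h0)))
  rw [Complex.exp_sub, turn, turn, (isArc hbs).exp_dlog (vert_notMem hbs hcs.symm h.symm),
    (isArc hcs).exp_dlog (vert_notMem hcs hbs.symm h)]
  have h1 := ne hbs
  have h2 := ne hcs
  have h3 := ne h
  have h4 := ne h.symm
  field_simp
  ring

/-- A short arc starting on the edge `s z` cannot be on the same side as `e` of the triangle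
`s z c` and on the same side as `c` of the triangle `s e z`. -/
theorem windAt_ne_or_ne (h : Four s e z c) (hp : p ∈ D.arc s z) (hps : p ≠ D.vert s)
    (hpz : p ≠ D.vert z) {S : Set (ℝ × ℝ)} (hS : IsArc S p q) (h1 : Disjoint (D.arc s e) S)
    (h2 : Disjoint (D.arc e z) S) (h3 : Disjoint (D.arc z c) S) (h4 : Disjoint (D.arc c s) S) :
    ¬(D.windAt s z c q = D.germ s z c e ∧ D.windAt s e z q = D.germ s e z c) := by
  rintro ⟨k1, k2⟩
  obtain ⟨A₁, A₂, hA₁, hA₂, hu, hi⟩ := (isArc h.ac).split hp hps hpz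
  have s₁ : A₁ ⊆ D.arc s z := hu ▸ subset_union_left
  have s₂ : A₂ ⊆ D.arc s z := hu ▸ subset_union_right
  have hz : D.vert z ∉ A₁ := fun hh ↦ hpz (by
    have : D.vert z ∈ A₁ ∩ A₂ := ⟨hh, hA₂.right_mem⟩
    rw [hi] at this
    exact this.symm)
  have hs : D.vert s ∉ A₂ := fun hh ↦ hps (by
    have : D.vert s ∈ A₁ ∩ A₂ := ⟨hA₁.left_mem, hh⟩
    rw [hi] at this
    exact this.symm)
  have d1 : Disjoint (D.arc s e) A₂ := disjoint_left.2 fun x hx hx2 ↦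
    hs (eq_vert_of_mem h.ac h.ab h.bc.symm (s₂ hx2) hx ▸ hx2)
  have d4 : Disjoint (D.arc c s) A₂ := disjoint_left.2 fun x hx hx2 ↦
    hs (eq_vert_of_mem h.ac h.ad h.cd (s₂ hx2) (D.arc_symm c s ▸ hx) ▸ hx2)
  have d2 : Disjoint (D.arc e z) A₁ := disjoint_left.2 fun x hx hx2 ↦
    hz (eq_vert_of_mem h.ac.symm h.bc.symm h.ab (D.arc_symm s z ▸ s₁ hx2)
      (D.arc_symm e z ▸ hx) ▸ hx2)
  have d3 : Disjoint (D.arc z c) A₁ := disjoint_left.2 fun x hx hx2 ↦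
    hz (eq_vert_of_mem h.ac.symm h.cd h.ad (D.arc_symm s z ▸ s₁ hx2) hx ▸ hx2)
  have e1 := (isArc h.ab).dlog_reciprocity hA₂ d1
  have e2 := (isArc h.bc).dlog_reciprocity hA₁ d2
  have e3 := (isArc h.cd).dlog_reciprocity hA₁ d3
  have e4 := (isArc h.ad.symm).dlog_reciprocity hA₂ d4
  have f1 := (isArc h.ab).dlog_reciprocity hS h1
  have f2 := (isArc h.bc).dlog_reciprocity hS h2
  have f3 := (isArc h.cd).dlog_reciprocity hS h3
  have f4 := (isArc h.ad.symm).dlog_reciprocity hS h4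
  have g1 := (isArc h.ac).dlog_add hA₁ hA₂ s₁ s₂ (vert_notMem h.ac h.ab.symm h.bc)
  have g2 := (isArc h.ac).dlog_add hA₁ hA₂ s₁ s₂ (vert_notMem h.ac h.ad.symm h.cd.symm)
  have key : (D.turn s e (D.vert z) - D.turn s z (D.vert e)) +
      (D.turn s z (D.vert c) - D.turn s c (D.vert z)) +
      (D.turn s c (D.vert e) - D.turn s e (D.vert c)) = 0 := by
    have t1 := turn_symm (D := D) s c
    have t2 := turn_symm (D := D) s z
    unfold germ windAt crossNum at k1 k2
    simp only [t1, t2] at k1 k2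
    unfold turn at k1 k2 t1 ⊢
    rw [show dlog (D.arc c s) (D.vert c) (D.vert s) (D.vert z) = _ from t1 _,
      show dlog (D.arc c s) (D.vert c) (D.vert s) p = _ from t1 _] at e4
    rw [show dlog (D.arc c s) (D.vert c) (D.vert s) q = _ from t1 _,
      show dlog (D.arc c s) (D.vert c) (D.vert s) p = _ from t1 _] at f4
    linear_combination (k1 + k2 + e1 - e2 - e3 + e4 - f1 - f2 - f3 - f4 - g1 + g2) / 2
  have := congrArg Complex.exp key
  rw [Complex.exp_zero, Complex.exp_add, Complex.exp_add, exp_turn_sub h.ab h.ac h.bc,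
    exp_turn_sub h.ac h.ad h.cd, exp_turn_sub h.ad h.ab h.bd.symm] at this
  have ne : ∀ {i j : Fin n}, i ≠ j → cx (D.vert i) - cx (D.vert j) ≠ 0 := fun hij h0 ↦
    hij (D.vert_inj (cx.injective (sub_eq_zero.1 h0)))
  have n1 := ne h.ab
  have n2 := ne h.ac
  have n3 := ne h.ad
  field_simp at this
  norm_num at this

end SimpleDrawing

namespace SimpleDrawing

open PlaneCurve Topology

variable {n : ℕ} {D : SimpleDrawing n} {s z c e u y : Fin n} {k : ℂ} {p q r : ℝ × ℝ}
  {P V Q : Set (ℝ × ℝ)}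

theorem disjoint_of_notMem (huy : u ≠ y) (huc : u ≠ c) (hyc : y ≠ c) (hP : P ⊆ D.arc u y)
    (hyP : D.vert y ∉ P) : Disjoint (D.arc y c) P := disjoint_left.2 fun _ hx hxP ↦
  hyP (eq_vert_of_mem huy.symm hyc huc (D.arc_symm u y ▸ hP hxP) hx ▸ hxP)

theorem disjoint_of_subset (huy : u ≠ y) (hzc : z ≠ c) (hne : s(u, y) ≠ s(z, c))
    (hP : P ⊆ D.arc u y) (hQ : Q ⊆ D.arc u y) (hPQ : Disjoint P Q)
    (h : ¬Disjoint (D.arc z c) P) : Disjoint (D.arc z c) Q := by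
  obtain ⟨x, hx, hxP⟩ := not_disjoint_iff.1 h
  refine disjoint_left.2 fun x' hx' hxQ ↦ disjoint_left.1 hPQ hxP ?_
  rwa [D.inter_subsingleton u y z c huy hzc hne ⟨hP hxP, hx⟩ ⟨hQ hxQ, hx'⟩]

variable (D) in
/-- The edges `u z` and `y z` do not enter the sector between `z` and `c`, where `c` is next
to `z` and `e` is on the other side of `z`. -/
structure IsNext (s z u y c e : Fin n) : Prop where
  crossNum_left : u ≠ c → D.crossNum s u z c = 0
  germ_left : u ≠ c → D.germ s z c u = D.germ s z c e
  crossNum_right : y ≠ c → D.crossNum s y z c = 0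
  germ_right : y ≠ c → D.germ s z c y = D.germ s z c e
  germ_eq : u ≠ c → y ≠ c → D.germ s u y c = D.germ s u y z

theorem IsNext.symm (h : D.IsNext s z u y c e) : D.IsNext s z y u c e :=
  ⟨h.crossNum_right, h.germ_right, h.crossNum_left, h.germ_left, fun hy hu ↦ by
    rw [germ_swap, h.germ_eq hu hy, ← germ_swap]⟩

/-- The configuration of an edge `u y` meeting `s z` with vanishing algebraic crossing number. -/
structure IsTouch (D : SimpleDrawing n) (s z u y : Fin n) (k : ℂ) (p : ℝ × ℝ)
    (P V Q : Set (ℝ × ℝ)) (q r : ℝ × ℝ) : Prop where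
  four : Four s z u y
  mem : p ∈ D.arc s z
  mem' : p ∈ D.arc u y
  cut : IsCut (D.arc u y) (D.vert u) (D.vert y) p P V Q q r
  disjoint : ∀ x, x ≠ s → x ≠ z → Disjoint (D.arc s x) V ∧ Disjoint (D.arc z x) V
  crossNum_eq_zero : D.crossNum s z u y = 0
  convex : D.IsConvexValue s u y k

namespace IsTouch

theorem symm (h : IsTouch D s z u y k p P V Q q r) : IsTouch D s z y u (-k) p Q V P r q :=
  ⟨⟨h.four.ab, h.four.ad, h.four.ac, h.four.bd, h.four.bc, h.four.cd.symm⟩, h.mem,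
    D.arc_symm u y ▸ h.mem', D.arc_symm u y ▸ h.cut.symm, h.disjoint,
    by rw [crossNum_symm_right, h.crossNum_eq_zero, neg_zero], h.convex.swap⟩

theorem disjoint_left (h : IsTouch D s z u y k p P V Q q r) : Disjoint (D.arc s z) P := by
  refine Set.disjoint_left.2 fun x hx hxP ↦ h.cut.p_notMem_P ?_
  have hne : s(u, y) ≠ s(s, z) := fun he ↦ by
    rcases Sym2.eq_iff.1 he with h1 | h1
    exacts [h.four.ac h1.1.symm, h.four.bc h1.1.symm]
  rwa [D.inter_subsingleton u y s z h.four.cd h.four.ab hne ⟨h.mem', h.mem⟩ ⟨h.cut.subP hxP, hx⟩]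

theorem arcCross_eq_zero (h : IsTouch D s z u y k p P V Q q r) :
    arcCross (D.arc s z) (D.vert s) (D.vert z) V q r = 0 := by
  have h0 := h.crossNum_eq_zero
  have h4 := h.four
  rw [crossNum_eq_arcCross, h.cut.arcCross_eq (isArc h4.cd) _ (vert_notMem h4.cd h4.ac h4.ad)
    (vert_notMem h4.cd h4.bc h4.bd),
    PlaneCurve.arcCross_eq_zero (isArc h4.ab) h.cut.arcP h.disjoint_left,
    PlaneCurve.arcCross_eq_zero (isArc h4.ab) h.cut.arcQ h.symm.disjoint_left] at h0
  simpa using h0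

theorem windAt_eq (h : IsTouch D s z u y k p P V Q q r) (hcs : c ≠ s) (hcz : c ≠ z) :
    D.windAt s z c r = D.windAt s z c q := by
  obtain ⟨h1, h2⟩ := h.disjoint c hcs hcz
  have := wind_sub_wind (D.arc s z) (D.arc z c) (D.arc c s) V (D.vert s) (D.vert z) (D.vert c) q r
  rw [h.arcCross_eq_zero, PlaneCurve.arcCross_eq_zero (isArc hcz.symm) h.cut.arcV h2,
    PlaneCurve.arcCross_eq_zero (isArc hcs) h.cut.arcV (D.arc_symm s c ▸ h1), add_zero, add_zero,
    sub_eq_zero] at this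
  exact this

theorem windAt_left (h : IsTouch D s z u y k p P V Q q r) (hcs : c ≠ s) (hcz : c ≠ z)
    (h1 : Disjoint (D.arc z c) P) (h2 : Disjoint (D.arc s c) P) :
    D.windAt s z c q = D.windAt s z c (D.vert u) :=
  ((isTri h.four.ab hcz.symm hcs.symm).wind_eq_of_isArc h.cut.arcP
    ((h.disjoint_left.union_left h1).union_left (D.arc_symm s c ▸ h2)).symm).symm

theorem windAt_z_ne (h : IsTouch D s z u y k p P V Q q r) {S : Set (ℝ × ℝ)} (hS : IsArc S p q)
    (hSV : S ⊆ V) : D.windAt s u y (D.vert z) ≠ k := by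
  have h4 := h.four
  have hps : p ≠ D.vert s := fun he ↦ vert_notMem h4.cd h4.ac h4.ad (he ▸ h.mem')
  have hpz : p ≠ D.vert z := fun he ↦ vert_notMem h4.cd h4.bc h4.bd (he ▸ h.mem')
  obtain ⟨du1, du2⟩ := h.disjoint u h4.ac.symm h4.bc.symm
  obtain ⟨dy1, dy2⟩ := h.disjoint y h4.ad.symm h4.bd.symm
  have hF := windAt_ne_or_ne (D := D) (p := p) (q := q) (S := S)
    (⟨h4.ac, h4.ab, h4.ad, h4.bc.symm, h4.cd, h4.bd⟩ : Four s u z y) h.mem hps hpz hS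
    (du1.mono_right hSV) (D.arc_symm z u ▸ du2.mono_right hSV) (dy2.mono_right hSV)
    (D.arc_symm s y ▸ dy1.mono_right hSV)
  have hu : D.windAt s z y q = D.windAt s z y (D.vert u) := by
    refine h.windAt_left h4.ad.symm h4.bd.symm ?_ ?_
    · exact D.arc_symm y z ▸ disjoint_of_notMem h4.cd h4.bc.symm h4.bd.symm
        h.cut.subP h.cut.b_notMem_P
    · exact D.arc_symm y s ▸ disjoint_of_notMem h4.cd h4.ac.symm h4.ad.symm
        h.cut.subP h.cut.b_notMem_P
  have hy : D.windAt s z u r = D.windAt s z u (D.vert y) := by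
    refine h.symm.windAt_left h4.ac.symm h4.bc.symm ?_ ?_
    · exact D.arc_symm u z ▸ disjoint_of_notMem h4.cd.symm h4.bd.symm h4.bc.symm h.symm.cut.subP
        h.symm.cut.b_notMem_P
    · exact D.arc_symm u s ▸ disjoint_of_notMem h4.cd.symm h4.ad.symm h4.ac.symm h.symm.cut.subP
        h.symm.cut.b_notMem_P
  rw [h.windAt_eq h4.ac.symm h4.bc.symm] at hy
  refine h.convex.ne ⟨h4.ac, h4.ad, h4.ab, h4.cd, h4.bc.symm, h4.bd.symm⟩ (Or.inr ?_)
  by_contra! hX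
  refine hF ⟨?_, ?_⟩
  · rw [hu, SimpleDrawing.germ_eq]
    rw [crossNum_symm_right, hX.2, neg_zero]
  · rw [windAt_swap, hy, ← windAt_swap, SimpleDrawing.germ_eq hX.1]

theorem windAt_eq_germ_of (h : IsTouch D s z u y k p P V Q q r) (hn : D.IsNext s z u y c e)
    (hz : D.windAt s u y (D.vert z) ≠ k) (hcs : c ≠ s) (hcz : c ≠ z) (hu : u ≠ c)
    (hP : y ≠ c → Disjoint (D.arc z c) P) : D.windAt s z c q = D.germ s z c e := by
  have h4 := h.four
  have hg : D.windAt s z c (D.vert u) = D.germ s z c e := by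
    rw [← hn.germ_left hu, SimpleDrawing.germ_eq (hn.crossNum_left hu)]
  have hPz : Disjoint (D.arc z c) P := by
    by_cases hy : y = c
    · subst hy
      exact D.arc_symm y z ▸
        disjoint_of_notMem h4.cd h4.bc.symm h4.bd.symm h.cut.subP h.cut.b_notMem_P
    · exact hP hy
  by_cases hPs : Disjoint (D.arc s c) P
  · rw [h.windAt_left hcs hcz hPz hPs, hg]
  have hy : y ≠ c := by
    rintro rfl
    exact hPs (D.arc_symm y s ▸
      disjoint_of_notMem h4.cd h4.ac.symm h4.ad.symm h.cut.subP h.cut.b_notMem_P)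
  have hne : s(u, y) ≠ s(s, c) := fun he ↦ by
    rcases Sym2.eq_iff.1 he with h1 | h1
    exacts [h4.ac h1.1.symm, hu h1.1]
  have hQs := disjoint_of_subset h4.cd hcs.symm hne h.cut.subP h.cut.subQ h.cut.disjoint hPs
  by_contra hne
  have hX : D.crossNum s c u y ≠ 0 := by
    intro hX
    refine hne ?_
    rw [← hg, ← sub_eq_zero]
    have := wind_sub_wind (D.arc s z) (D.arc z c) (D.arc c s) P (D.vert s) (D.vert z) (D.vert c)
      (D.vert u) q
    refine this.trans ?_
    rw [PlaneCurve.arcCross_eq_zero (isArc h4.ab) h.cut.arcP h.disjoint_left,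
      PlaneCurve.arcCross_eq_zero (isArc hcz.symm) h.cut.arcP hPz, zero_add, zero_add]
    rw [← neg_eq_zero, ← crossNum_symm_left, crossNum_eq_arcCross,
      h.cut.arcCross_eq (isArc h4.cd) _ (vert_notMem h4.cd hu.symm hy.symm)
      (vert_notMem h4.cd h4.ac h4.ad),
      PlaneCurve.arcCross_eq_zero (isArc hcs) h.cut.arcV
        (D.arc_symm s c ▸ (h.disjoint c hcs hcz).1),
      PlaneCurve.arcCross_eq_zero (isArc hcs) h.cut.arcQ (D.arc_symm s c ▸ hQs), add_zero,
      add_zero] at hX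
    exact hX
  have hc4 : Four s u y c := ⟨h4.ac, h4.ad, hcs.symm, h4.cd, hu, hy⟩
  have hck := h.convex.ne hc4 (Or.inl hX)
  have he := h.convex.eq_of_ne h4.ac h4.cd h4.ad (vert_notMem_tri hc4)
    (vert_notMem_tri ⟨h4.ac, h4.ad, h4.ab, h4.cd, h4.bc.symm, h4.bd.symm⟩) hck hz
  have hgu := hn.germ_eq hu hy
  rw [SimpleDrawing.germ_eq h.crossNum_eq_zero, germ, he] at hgu
  exact hX (add_eq_left.1 hgu)

theorem windAt_eq_germ (h : IsTouch D s z u y k p P V Q q r) (hn : D.IsNext s z u y c e)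
    (hz : D.windAt s u y (D.vert z) ≠ k) (hcs : c ≠ s) (hcz : c ≠ z) :
    D.windAt s z c q = D.germ s z c e := by
  have h4 := h.four
  have hz' : D.windAt s y u (D.vert z) ≠ -k := by
    rwa [windAt_swap, ne_eq, neg_inj]
  by_cases hu : u = c
  · rw [← h.windAt_eq hcs hcz]
    exact h.symm.windAt_eq_germ_of hn.symm hz' hcs hcz (hu ▸ h4.cd.symm) (absurd hu)
  by_cases hP : Disjoint (D.arc z c) P
  · exact h.windAt_eq_germ_of hn hz hcs hcz hu fun _ ↦ hP
  by_cases hy : y = c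
  · exact h.windAt_eq_germ_of hn hz hcs hcz hu fun hy' ↦ absurd hy hy'
  have hne : s(u, y) ≠ s(z, c) := fun he ↦ by
    rcases Sym2.eq_iff.1 he with h1 | h1
    exacts [h4.bc h1.1.symm, hu h1.1]
  rw [← h.windAt_eq hcs hcz]
  exact h.symm.windAt_eq_germ_of hn.symm hz' hcs hcz hy fun _ ↦
    disjoint_of_subset h4.cd hcz.symm hne h.cut.subP h.cut.subQ h.cut.disjoint hP

end IsTouch

/-- If the edge `u y` meets the star edge `s z` whose neighbours `c` and `e` are not separated
from `z` by the edges at `u` and `y`, then it crosses it algebraically. -/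
theorem crossNum_ne_zero_of_not_disjoint (h : Four s z u y) (hk : D.IsConvexValue s u y k)
    (hce : c ≠ e) (hcs : c ≠ s) (hcz : c ≠ z) (hes : e ≠ s) (hez : e ≠ z)
    (hc : D.IsNext s z u y c e) (he : D.IsNext s z u y e c)
    (hM : ¬Disjoint (D.arc u y) (D.arc s z)) : D.crossNum s z u y ≠ 0 := by
  intro h0
  obtain ⟨p, hp, hpz⟩ := not_disjoint_iff.1 hM
  have hps : p ≠ D.vert s := fun he ↦ vert_notMem h.cd h.ac h.ad (he ▸ hp)
  have hpz' : p ≠ D.vert z := fun he ↦ vert_notMem h.cd h.bc h.bd (he ▸ hp)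
  have hpu : p ≠ D.vert u := fun he ↦ vert_notMem h.ab h.ac.symm h.bc.symm (he ▸ hpz)
  have hpy : p ≠ D.vert y := fun he ↦ vert_notMem h.ab h.ad.symm h.bd.symm (he ▸ hpz)
  have hU : {x | ∀ j, j ≠ s → j ≠ z → x ∉ D.arc s j ∧ x ∉ D.arc z j} ∈ 𝓝 p := by
    refine Filter.eventually_all.2 fun j ↦ ?_
    by_cases hjs : j = s
    · exact Filter.Eventually.of_forall fun _ h _ ↦ absurd hjs h
    by_cases hjz : j = z
    · exact Filter.Eventually.of_forall fun _ _ h ↦ absurd hjz h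
    filter_upwards [(isArc (D := D) (Ne.symm hjs)).isClosed.isOpen_compl.mem_nhds fun h1 ↦
        hps (eq_vert_of_mem h.ab (Ne.symm hjs) (Ne.symm hjz) hpz h1),
      (isArc (D := D) (Ne.symm hjz)).isClosed.isOpen_compl.mem_nhds fun h1 ↦
        hpz' (eq_vert_of_mem h.ab.symm (Ne.symm hjz) (Ne.symm hjs) (D.arc_symm s z ▸ hpz) h1)]
      with x h1 h2 _ _
    exact ⟨h1, h2⟩
  obtain ⟨P, V, Q, q, r, hcut, hVU, S, hS, hSV⟩ := (isArc (D := D) h.cd).exists_isCut hp hpu hpy hU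
  have hT : IsTouch D s z u y k p P V Q q r :=
    ⟨h, hpz, hp, hcut, fun j hs hz ↦
      ⟨disjoint_right.2 fun x hx ↦ (hVU hx j hs hz).1,
        disjoint_right.2 fun x hx ↦ (hVU hx j hs hz).2⟩, h0, hk⟩
  have hz := hT.windAt_z_ne hS hSV
  obtain ⟨dc1, dc2⟩ := hT.disjoint c hcs hcz
  obtain ⟨de1, de2⟩ := hT.disjoint e hes hez
  refine windAt_ne_or_ne (D := D)
    (⟨hes.symm, h.ab, hcs.symm, hez, hce.symm, hcz.symm⟩ : Four s e z c)
    hpz hps hpz' hS (de1.mono_right hSV) (D.arc_symm z e ▸ de2.mono_right hSV)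
    (dc2.mono_right hSV) (D.arc_symm s c ▸ dc1.mono_right hSV)
    ⟨hT.windAt_eq_germ hc hz hcs hcz, ?_⟩
  rw [windAt_swap, germ_swap, hT.windAt_eq_germ he hz hes hez]

end SimpleDrawing

namespace SimpleDrawing

open PlaneCurve Topology

variable {n : ℕ} {D : SimpleDrawing n} {s : Fin n} {lab : Fin (n - 1) → Fin n}
  {a b c d e f u x y z : Fin (n - 1)} {k : ℂ}

/-- Two edges meeting at a common endpoint do not cross. -/
theorem Crosses.four {i j k l : Fin n} (h : D.Crosses s(i, j) s(k, l)) (hij : i ≠ j)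
    (hkl : k ≠ l) : Four i j k l := by
  obtain ⟨hne, p, ⟨hp, hp'⟩, hcon⟩ := h
  have aux : ∀ {i j k l : Fin n}, i ≠ j → k ≠ l → s(i, j) ≠ s(k, l) → p ∈ D.arc i j →
      p ∈ D.arc k l → (¬∃ a, a ∈ s(i, j) ∧ a ∈ s(k, l) ∧ p = D.vert a) → i ≠ k := by
    rintro i j k l hij hkl hne hp hp' hcon rfl
    refine hcon ⟨i, by simp, by simp, eq_vert_of_mem hij hkl ?_ hp hp'⟩
    rintro rfl
    exact hne rfl
  refine ⟨hij, aux hij hkl hne hp hp' hcon, ?_, ?_, ?_, hkl⟩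
  · refine aux hij hkl.symm ?_ hp (D.arc_symm k l ▸ hp') ?_ <;> rwa [Sym2.eq_swap (a := l)]
  · refine aux hij.symm hkl ?_ (D.arc_symm i j ▸ hp) hp' ?_ <;> rwa [Sym2.eq_swap (a := j)]
  · refine aux hij.symm hkl.symm ?_ (D.arc_symm i j ▸ hp) (D.arc_symm k l ▸ hp') ?_ <;>
      rwa [Sym2.eq_swap (a := j), Sym2.eq_swap (a := l)]

theorem crosses_iff {i j k l : Fin n} (h : Four i j k l) :
    D.Crosses s(i, j) s(k, l) ↔ ¬Disjoint (D.arc i j) (D.arc k l) := by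
  constructor
  · rintro ⟨-, p, ⟨hp, hp'⟩, -⟩ hd
    exact disjoint_left.1 hd hp hp'
  · intro hd
    obtain ⟨p, hp, hp'⟩ := not_disjoint_iff.1 hd
    refine ⟨fun he ↦ ?_, p, ⟨hp, hp'⟩, ?_⟩
    · rcases Sym2.eq_iff.1 he with h1 | h1
      exacts [h.ac h1.1, h.ad h1.1]
    · rintro ⟨a, ha, ha', -⟩
      rcases Sym2.mem_iff.1 ha with rfl | rfl <;> rcases Sym2.mem_iff.1 ha' with h1 | h1
      exacts [h.ac h1, h.ad h1, h.bc h1, h.bd h1]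

theorem germ_eq_of_ne {i j k l m : Fin n} (h1 : Four i j k l) (h2 : Four i j k m) {x : Fin n}
    (h3 : Four i j k x) (hl : D.germ i j k l ≠ D.germ i j k x)
    (hm : D.germ i j k m ≠ D.germ i j k x) : D.germ i j k l = D.germ i j k m := by
  obtain ⟨p, -, -, -, hp, hp'⟩ := exists_windAt_eq_germ (D := D) h1 Filter.univ_mem
  obtain ⟨q, -, -, -, hq, hq'⟩ := exists_windAt_eq_germ (D := D) h2 Filter.univ_mem
  obtain ⟨r, -, -, -, hr, hr'⟩ := exists_windAt_eq_germ (D := D) h3 Filter.univ_mem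
  rw [← hp', ← hr'] at hl
  rw [← hq', ← hr'] at hm
  rw [← hp', ← hq']
  have := windAt_two_valued h1.ab h1.bc h1.ac hp hq hr
  tauto

/-- The label `c` lies strictly between the labels `a` and `b`. -/
def Btw (a b c : Fin (n - 1)) : Prop :=
  (a.val < c.val ∧ c.val < b.val) ∨ (b.val < c.val ∧ c.val < a.val)

/-- A rotation labeling with at least seven labels. -/
structure IsStarLabeling (D : SimpleDrawing n) (s : Fin n) (lab : Fin (n - 1) → Fin n) : Prop where
  convex : D.Convex
  rotation : D.IsRotationLabeling s lab
  seven_le : 7 ≤ n - 1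

namespace IsStarLabeling

theorem lab_ne (h : D.IsRotationLabeling s lab) (a : Fin (n - 1)) : s ≠ lab a := by
  have : lab a ∈ range lab := ⟨a, rfl⟩
  rw [h.2.1] at this
  exact fun h ↦ this h.symm

variable (h : IsStarLabeling D s lab)
include h

theorem ne (hab : a ≠ b) : lab a ≠ lab b := fun he ↦ hab (h.rotation.1 he)

theorem four (hab : a ≠ b) (hac : a ≠ c) (hbc : b ≠ c) : Four s (lab a) (lab b) (lab c) :=
  ⟨lab_ne h.rotation a, lab_ne h.rotation b, lab_ne h.rotation c, h.ne hab, h.ne hac, h.ne hbc⟩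

theorem germ_ne_of_lt (hac : a < c) (hcb : c < b) (hd : d < a ∨ b < d) :
    D.germ s (lab a) (lab b) (lab c) ≠ D.germ s (lab a) (lab b) (lab d) := by
  rcases hd with hda | hbd
  · have hs := (h.rotation.2.2 d a c b hda hac hcb).germ_ne
      (h.four (hda.trans hac).ne hda.ne hac.ne')
      (h.four (hda.trans hac).ne (hda.trans (hac.trans hcb)).ne hcb.ne)
    intro he
    have := germ_eq_comm he
    rw [germ_swap, germ_swap s (lab d) (lab c), neg_inj] at this
    exact hs this
  · exact (h.rotation.2.2 a c b d hac hcb hbd).germ_ne (h.four (hac.trans hcb).ne hac.ne hcb.ne')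
      (h.four (hac.trans hcb).ne (hac.trans (hcb.trans hbd)).ne hbd.ne)

theorem germ_ne (hc : Btw a b c) (hd : ¬Btw a b d) (hda : d ≠ a) (hdb : d ≠ b) :
    D.germ s (lab a) (lab b) (lab c) ≠ D.germ s (lab a) (lab b) (lab d) := by
  unfold Btw at hc hd
  rw [ne_eq, Fin.ext_iff] at hda hdb
  rcases hc with hc | hc
  · exact h.germ_ne_of_lt hc.1 hc.2 (by rw [Fin.lt_def, Fin.lt_def]; omega)
  · have := h.germ_ne_of_lt (d := d) (Fin.lt_def.2 hc.1) (Fin.lt_def.2 hc.2)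
      (by rw [Fin.lt_def, Fin.lt_def]; omega)
    rw [germ_swap s (lab b) (lab a), germ_swap s (lab b) (lab a)]
    exact fun he ↦ this (neg_injective he)

/-- Two labels separated from a third one have the same side. -/
theorem germ_eq_of_btw (hab : a ≠ b) (hca : c ≠ a) (hcb : c ≠ b) (hda : d ≠ a) (hdb : d ≠ b)
    (hea : e ≠ a) (heb : e ≠ b) (hc : Btw a b c ↔ ¬Btw a b e) (hd : Btw a b d ↔ ¬Btw a b e) :
    D.germ s (lab a) (lab b) (lab c) = D.germ s (lab a) (lab b) (lab d) := by
  have key : ∀ {x}, x ≠ a → x ≠ b → (Btw a b x ↔ ¬Btw a b e) →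
      D.germ s (lab a) (lab b) (lab x) ≠ D.germ s (lab a) (lab b) (lab e) := by
    intro x hxa hxb hx
    by_cases he : Btw a b e
    · exact (h.germ_ne he (fun hh ↦ hx.1 hh he) hxa hxb).symm
    · exact h.germ_ne (hx.2 he) he hea heb
  exact germ_eq_of_ne (h.four hab hca.symm hcb.symm) (h.four hab hda.symm hdb.symm)
    (h.four hab hea.symm heb.symm) (key hca hcb hc) (key hda hdb hd)

/-- Labels `c` and `d` lie on the same side of `a b` if both pairs `c e` and `d e` separate `a`
and `b` from some label. -/
theorem germ_eq_of_intermediate (hca : c ≠ a) (hcb : c ≠ b) (hda : d ≠ a)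
    (hdb : d ≠ b) (hea : e ≠ a) (heb : e ≠ b) (hec : e ≠ c) (hed : e ≠ d)
    (hf : f ≠ c ∧ f ≠ e ∧ (Btw c e a ↔ ¬Btw c e f) ∧ (Btw c e b ↔ ¬Btw c e f))
    (hx : x ≠ d ∧ x ≠ e ∧ (Btw d e a ↔ ¬Btw d e x) ∧ (Btw d e b ↔ ¬Btw d e x)) :
    D.germ s (lab a) (lab b) (lab c) = D.germ s (lab a) (lab b) (lab d) := by
  have h1 := germ_eq_comm (h.germ_eq_of_btw hec.symm hca.symm hea.symm hcb.symm heb.symm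
    hf.1 hf.2.1 hf.2.2.1 hf.2.2.2)
  have h2 := germ_eq_comm (h.germ_eq_of_btw hed.symm hda.symm hea.symm hdb.symm heb.symm
    hx.1 hx.2.1 hx.2.2.1 hx.2.2.2)
  exact h1.trans h2.symm

theorem germ_eq_of_lt (hab : a < b) (hcd : c < d) (hac : a < c) (hcb : c ≠ b) (hdb : d ≠ b)
    (hside : Btw a b c ↔ Btw a b d) :
    D.germ s (lab a) (lab b) (lab c) = D.germ s (lab a) (lab b) (lab d) := by
  have h7 := h.seven_le
  have ha := a.isLt
  have hb := b.isLt
  have hd := d.isLt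
  have e1 : ∀ i (hi : i < n - 1), (i < a.val ∨ b.val < i) ∧ c < b ∨
      (a.val < i ∧ i < b.val) ∧ b < c →
      D.germ s (lab a) (lab b) (lab c) = D.germ s (lab a) (lab b) (lab d) := by
    intro i hi hh
    refine h.germ_eq_of_btw (e := ⟨i, hi⟩) hab.ne hac.ne' hcb (hac.trans hcd).ne' hdb
      ?_ ?_ ?_ ?_ <;>
      simp only [Btw, Fin.lt_def, Fin.ext_iff, ne_eq] at * <;> omega
  have e2 : c.val + 1 < d.val →
      D.germ s (lab a) (lab b) (lab c) = D.germ s (lab a) (lab b) (lab d) := by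
    intro hh
    refine germ_eq_comm (h.germ_eq_of_btw (e := ⟨c + 1, hh.trans hd⟩) hcd.ne hac.ne
      (hac.trans hcd).ne ?_ ?_ ?_ ?_ ?_ ?_) <;>
      simp only [Btw, Fin.lt_def, Fin.ext_iff, ne_eq] at * <;> omega
  have e3 : ∀ i (hi : i < n - 1) j (hj : j < n - 1) k (hk : k < n - 1),
      i ≠ a → i ≠ b → i ≠ c → i ≠ d → j ≠ c → j ≠ i → k ≠ d → k ≠ i →
      (Btw c ⟨i, hi⟩ a ↔ ¬Btw c ⟨i, hi⟩ ⟨j, hj⟩) → (Btw c ⟨i, hi⟩ b ↔ ¬Btw c ⟨i, hi⟩ ⟨j, hj⟩) →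
      (Btw d ⟨i, hi⟩ a ↔ ¬Btw d ⟨i, hi⟩ ⟨k, hk⟩) → (Btw d ⟨i, hi⟩ b ↔ ¬Btw d ⟨i, hi⟩ ⟨k, hk⟩) →
      D.germ s (lab a) (lab b) (lab c) = D.germ s (lab a) (lab b) (lab d) := by
    intro i hi j hj k hk h1 h2 h3 h4 h5 h6 h7 h8 h9 h10 h11 h12
    refine h.germ_eq_of_intermediate (e := ⟨i, hi⟩) (f := ⟨j, hj⟩) (x := ⟨k, hk⟩) hac.ne' hcb
      (hac.trans hcd).ne' hdb ?_ ?_ ?_ ?_ ⟨?_, ?_, h9, h10⟩ ⟨?_, ?_, h11, h12⟩ <;>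
      simpa only [Fin.ext_iff, ne_eq]
  simp only [Btw, Fin.lt_def, Fin.ext_iff, ne_eq] at hab hcd hac hcb hdb hside e1 e3
  rcases lt_or_gt_of_ne hcb with hcb | hbc
  · by_cases h1 : 0 < a.val
    · exact e1 0 (by omega) (by omega)
    by_cases h2 : b.val < n - 2
    · exact e1 (n - 2) (by omega) (by omega)
    by_cases h3 : c.val + 1 < d.val
    · exact e2 h3
    by_cases h4 : 3 ≤ c.val
    · apply e3 1 (by omega) 2 (by omega) c.val (by omega) <;> omega
    · apply e3 (n - 3) (by omega) d.val (by omega) (n - 4) (by omega) <;> omega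
  · by_cases h1 : a.val + 1 < b.val
    · exact e1 (a + 1) (by omega) (by omega)
    by_cases h2 : c.val + 1 < d.val
    · exact e2 h2
    by_cases h3 : b.val + 3 ≤ c.val
    · apply e3 (b + 1) (by omega) (b + 2) (by omega) c.val (by omega) <;> omega
    by_cases h4 : 2 ≤ a.val
    · apply e3 (a - 1) (by omega) d.val (by omega) 0 (by omega) <;> omega
    by_cases h5 : 1 ≤ a.val
    · apply e3 (a - 1) (by omega) d.val (by omega) (n - 2) (by omega) <;> omega
    · apply e3 (n - 2) (by omega) d.val (by omega) (n - 3) (by omega) <;> omega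

theorem germ_eq (hab : a ≠ b) (hca : c ≠ a) (hcb : c ≠ b) (hda : d ≠ a) (hdb : d ≠ b)
    (hside : Btw a b c ↔ Btw a b d) :
    D.germ s (lab a) (lab b) (lab c) = D.germ s (lab a) (lab b) (lab d) := by
  rcases eq_or_ne c d with rfl | hcd
  · rfl
  wlog hab' : a < b generalizing a b
  · rw [germ_swap, germ_swap s (lab b)]
    refine congrArg _ (this hab.symm hcb hca hdb hda ?_ (lt_of_le_of_ne (not_lt.1 hab') hab.symm))
    unfold Btw at *
    omega
  have key : ∀ {c d}, c < d → c ≠ a → c ≠ b → d ≠ a → d ≠ b → (Btw a b c ↔ Btw a b d) →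
      D.germ s (lab a) (lab b) (lab c) = D.germ s (lab a) (lab b) (lab d) := by
    intro c d hcd hca hcb hda hdb hside
    rcases lt_or_gt_of_ne hca with hac | hac
    · refine germ_eq_comm (h.germ_eq_of_lt hcd hab' hac hda.symm hdb.symm ?_)
      simp only [Btw, Fin.lt_def, Fin.ext_iff, ne_eq] at *
      omega
    · exact h.germ_eq_of_lt hab' hcd hac hcb hdb hside
  rcases lt_or_gt_of_ne hcd with hcd | hcd
  · exact key hcd hca hcb hda hdb hside
  · exact (key hcd hda hdb hca hcb hside.symm).symm

end IsStarLabeling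
end SimpleDrawing

theorem finCycSucc_val {m : ℕ} (a : Fin m) :
    (a.val + 1 < m ∧ (finCycSucc a).val = a.val + 1) ∨
      (a.val + 1 = m ∧ (finCycSucc a).val = 0) := by
  have ha := a.isLt
  rcases lt_or_ge (a.val + 1) m with h | h
  · exact Or.inl ⟨h, Nat.mod_eq_of_lt h⟩
  · have : a.val + 1 = m := by omega
    exact Or.inr ⟨this, by simp [finCycSucc, this]⟩

namespace SimpleDrawing

variable {n : ℕ} {D : SimpleDrawing n} {s : Fin n} {lab : Fin (n - 1) → Fin n}
  {a b c d e u w x y z : Fin (n - 1)} {k : ℂ}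

namespace IsStarLabeling

variable (h : IsStarLabeling D s lab)
include h

theorem crosses_of_crossNum (hxy : x ≠ y) (hxw : x ≠ w) (hyw : y ≠ w)
    (hX : D.crossNum s (lab w) (lab x) (lab y) ≠ 0) :
    D.Crosses s(lab x, lab y) s(lab w, s) := by
  have h4 := h.four hxy hxw hyw
  rw [crosses_iff ⟨h4.bc, h4.bd, h4.ab.symm, h4.cd, h4.ac.symm, h4.ad.symm⟩]
  intro hd
  refine hX (crossNum_eq_zero h4.ad h4.bc ?_)
  rwa [disjoint_comm, D.arc_symm s]

theorem disjoint_of_not_crosses (hxy : x ≠ y) (hxw : x ≠ w) (hyw : y ≠ w)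
    (hX : ¬D.Crosses s(lab x, lab y) s(lab w, s)) :
    Disjoint (D.arc s (lab w)) (D.arc (lab x) (lab y)) := by
  have h4 := h.four hxy hxw hyw
  rw [crosses_iff ⟨h4.bc, h4.bd, h4.ab.symm, h4.cd, h4.ac.symm, h4.ad.symm⟩, not_not] at hX
  rwa [disjoint_comm, D.arc_symm s]

theorem crossNum_eq_zero_of_not_crosses (hxy : x ≠ y) (hxw : x ≠ w) (hyw : y ≠ w)
    (hX : ¬D.Crosses s(lab x, lab y) s(lab w, s)) :
    D.crossNum s (lab w) (lab x) (lab y) = 0 := by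
  by_contra h0
  exact hX (h.crosses_of_crossNum hxy hxw hyw h0)

theorem isNext_succ (hzu : z ≠ u) (hzy : z ≠ y) (huy : u ≠ y) (he : finCycSucc e = z)
    (hu : ¬D.BadWitness s lab z u) (hy : ¬D.BadWitness s lab z y) :
    D.IsNext s (lab z) (lab u) (lab y) (lab (finCycSucc z)) (lab e) := by
  have h7 := h.seven_le
  have sz := finCycSucc_val z
  have se := finCycSucc_val e
  rw [he] at se
  have hc : z ≠ finCycSucc z := by rw [ne_eq, Fin.ext_iff]; omega
  have hez : e ≠ z := by rw [ne_eq, Fin.ext_iff]; omega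
  have hec : e ≠ finCycSucc z := by rw [ne_eq, Fin.ext_iff]; omega
  have key : ∀ v, z ≠ v → lab v ≠ lab (finCycSucc z) →
      D.germ s (lab z) (lab (finCycSucc z)) (lab v) =
        D.germ s (lab z) (lab (finCycSucc z)) (lab e) := by
    intro v hv hvc
    have hvc : v ≠ finCycSucc z := fun hh ↦ hvc (hh ▸ rfl)
    have hv' := v.isLt
    have he' := e.isLt
    refine h.germ_eq hc hv.symm hvc hez hec ?_
    simp only [Btw, Fin.ext_iff, ne_eq] at *
    omega
  refine ⟨fun huc ↦ ?_, key u hzu, fun hyc ↦ ?_, key y hzy, fun huc hyc ↦ ?_⟩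
  · exact h.crossNum_eq_zero_of_not_crosses hc hzu (fun hh ↦ huc (hh ▸ rfl)) hu
  · exact h.crossNum_eq_zero_of_not_crosses hc hzy (fun hh ↦ hyc (hh ▸ rfl)) hy
  · have huc : u ≠ finCycSucc z := fun hh ↦ huc (hh ▸ rfl)
    have hyc : y ≠ finCycSucc z := fun hh ↦ hyc (hh ▸ rfl)
    have hu' := u.isLt
    have hy' := y.isLt
    refine h.germ_eq huy huc.symm hyc.symm hzu hzy ?_
    simp only [Btw, Fin.ext_iff, ne_eq] at *
    omega

theorem isNext_pred (hzu : z ≠ u) (hzy : z ≠ y) (huy : u ≠ y) (he : finCycSucc e = z)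
    (hu : ¬D.BadWitness s lab e u) (hy : ¬D.BadWitness s lab e y) :
    D.IsNext s (lab z) (lab u) (lab y) (lab e) (lab (finCycSucc z)) := by
  have h7 := h.seven_le
  have sz := finCycSucc_val z
  have se := finCycSucc_val e
  rw [he] at se
  have hc : z ≠ finCycSucc z := by rw [ne_eq, Fin.ext_iff]; omega
  have hez : e ≠ z := by rw [ne_eq, Fin.ext_iff]; omega
  have hec : e ≠ finCycSucc z := by rw [ne_eq, Fin.ext_iff]; omega
  have key : ∀ v, z ≠ v → lab v ≠ lab e →
      D.germ s (lab z) (lab e) (lab v) = D.germ s (lab z) (lab e) (lab (finCycSucc z)) := by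
    intro v hv hvc
    have hve : v ≠ e := fun hh ↦ hvc (hh ▸ rfl)
    have hv' := v.isLt
    have he' := e.isLt
    refine h.germ_eq hez.symm hv.symm hve hc.symm hec.symm ?_
    simp only [Btw, Fin.ext_iff, ne_eq] at *
    omega
  refine ⟨fun hue ↦ ?_, key u hzu, fun hye ↦ ?_, key y hzy, fun hue hye ↦ ?_⟩
  · rw [crossNum_symm_right s (lab u) (lab e), neg_eq_zero]
    subst he
    exact h.crossNum_eq_zero_of_not_crosses hez (fun hh ↦ hue (hh ▸ rfl)) hzu hu
  · rw [crossNum_symm_right s (lab y) (lab e), neg_eq_zero]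
    subst he
    exact h.crossNum_eq_zero_of_not_crosses hez (fun hh ↦ hye (hh ▸ rfl)) hzy hy
  · have hue : u ≠ e := fun hh ↦ hue (hh ▸ rfl)
    have hye : y ≠ e := fun hh ↦ hye (hh ▸ rfl)
    have hu' := u.isLt
    have hy' := y.isLt
    refine h.germ_eq huy hue.symm hye.symm hzu hzy ?_
    simp only [Btw, Fin.ext_iff, ne_eq] at *
    omega

/-- An edge meeting the star edge of `z` has nonzero algebraic crossing number with it, unless
one of its ends witnesses a bad edge at `z`. -/
theorem crossNum_ne_zero (he : finCycSucc e = z)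
    (hzu : ¬D.BadWitness s lab z u) (hzy : ¬D.BadWitness s lab z y)
    (heu : ¬D.BadWitness s lab e u) (hey : ¬D.BadWitness s lab e y) (huy : u ≠ y)
    (hM : D.Crosses s(lab u, lab y) s(lab z, s)) :
    D.crossNum s (lab z) (lab u) (lab y) ≠ 0 := by
  have h7 := h.seven_le
  have h4 := hM.four (h.ne huy) (lab_ne h.rotation z).symm
  have huz : z ≠ u := fun hh ↦ h4.ac (hh ▸ rfl)
  have hyz : z ≠ y := fun hh ↦ h4.bc (hh ▸ rfl)
  have sz := finCycSucc_val z
  have se := finCycSucc_val e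
  rw [he] at se
  have hc : finCycSucc z ≠ z := by rw [ne_eq, Fin.ext_iff]; omega
  have hez : e ≠ z := by rw [ne_eq, Fin.ext_iff]; omega
  have hec : finCycSucc z ≠ e := by rw [ne_eq, Fin.ext_iff]; omega
  obtain ⟨k, hk⟩ := h.convex.exists_isConvexValue h4.ad.symm h4.ab h4.bd.symm
  rw [crosses_iff h4, D.arc_symm (lab z)] at hM
  exact crossNum_ne_zero_of_not_disjoint (h.four huz hyz huy) hk (h.ne hec)
    (lab_ne h.rotation _).symm (h.ne hc) (lab_ne h.rotation _).symm (h.ne hez)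
    (h.isNext_succ huz hyz huy he hzu hzy) (h.isNext_pred huz hyz huy he heu hey) hM

end IsStarLabeling
end SimpleDrawing

namespace SimpleDrawing

variable {n : ℕ} {D : SimpleDrawing n} {s i j p q r : Fin n} {lab : Fin (n - 1) → Fin n}
  {a b t u w x y z : Fin (n - 1)} {k : ℂ}

/-- If `s p` crosses `i j` whereas `s q`, leaving `s` on the same side of `s i j`, does not,
then `q` is on the convex side of `s i j`. -/
theorem IsConvexValue.windAt_eq_of_germ_eq (hk : D.IsConvexValue s i j k) (hp : Four s i j p)
    (hq : Four s i j q) (hpX : D.crossNum s p i j ≠ 0) (hqX : D.crossNum s q i j = 0)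
    (he : D.germ s i j q = D.germ s i j p) : D.windAt s i j (D.vert q) = k := by
  rw [SimpleDrawing.germ_eq hqX, germ] at he
  refine (hk.eq_or_eq hp.ab hp.bc hp.ac (vert_notMem_tri hq) (vert_notMem_tri hp) ?_).resolve_right
    (hk.ne hp (Or.inl hpX))
  rw [he]
  simpa using hpX

theorem crossNum_eq_zero_iff_of_windAt_eq {c : ℂ} (h : D.windAt s i j (D.vert p) = c) :
    D.crossNum s p i j = 0 ↔ D.germ s i j p = c := by
  rw [germ, h, add_eq_left]

namespace IsStarLabeling

variable (h : IsStarLabeling D s lab)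
include h

/-- An edge leaving the end `a + 1` or a label beyond it to the left of the witness `w` of a bad
edge crosses no star edge from `w` onwards. -/
theorem crossNum_eq_zero_of_le (huw : u < w) (hwa : w < a) (hab : b.val = a.val + 1) (hby : b ≤ y)
    (hw : D.crossNum s (lab w) (lab a) (lab b) ≠ 0)
    (hu : D.crossNum s (lab u) (lab a) (lab b) = 0)
    (hy : y ≠ b → D.crossNum s (lab y) (lab a) (lab b) = 0) (hwx : w ≤ x) (hxy : x < y) :
    D.crossNum s (lab x) (lab u) (lab y) = 0 := by
  obtain ⟨k, hk⟩ := h.convex.exists_isConvexValue (lab_ne h.rotation a) (h.ne (a := a) (b := b)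
    (by rw [ne_eq, Fin.ext_iff]; omega)) (lab_ne h.rotation b)
  simp only [Fin.lt_def, Fin.le_def, Fin.ext_iff, ne_eq] at huw hwa hby hwx hxy hy
  have four : ∀ {i j l : Fin (n - 1)}, i.val ≠ j.val → i.val ≠ l.val → j.val ≠ l.val →
      Four s (lab i) (lab j) (lab l) := fun h1 h2 h3 ↦
    h.four (fun hh ↦ h1 (hh ▸ rfl)) (fun hh ↦ h2 (hh ▸ rfl)) (fun hh ↦ h3 (hh ▸ rfl))
  have hwabk := four (i := a) (j := b) (l := w) (by omega) (by omega) (by omega)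
  have hwk := hk.ne hwabk (Or.inl hw)
  have hU : D.InSide s (lab a) (lab b) k (lab u) := by
    refine Or.inr (Or.inr (Or.inr (hk.windAt_eq_of_germ_eq hwabk ?_ hw hu
      (h.germ_eq ?_ ?_ ?_ ?_ ?_ ?_))))
    · exact four (by omega) (by omega) (by omega)
    all_goals simp only [Btw, Fin.ext_iff, ne_eq]; omega
  have hY : D.InSide s (lab a) (lab b) k (lab y) := by
    by_cases hyb : y.val = b.val
    · exact Or.inr (Or.inr (Or.inl (congrArg lab (Fin.ext hyb))))
    refine Or.inr (Or.inr (Or.inr (hk.windAt_eq_of_germ_eq hwabk ?_ hw (hy hyb)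
      (h.germ_eq ?_ ?_ ?_ ?_ ?_ ?_))))
    · exact four (by omega) (by omega) (by omega)
    all_goals simp only [Btw, Fin.ext_iff, ne_eq]; omega
  have hwu : D.crossNum s (lab w) (lab u) (lab y) = 0 := by
    rw [crossNum_eq_zero_iff_of_windAt_eq (hk.windAt_eq_germ hwabk
      (four (by omega) (by omega) (by omega)) hU hY hwk)]
    apply h.germ_eq
    all_goals simp only [Btw, Fin.ext_iff, ne_eq]; omega
  by_cases hxw : x.val = w.val
  · rwa [Fin.ext hxw]
  by_contra hx
  obtain ⟨k₂, hk₂⟩ := h.convex.exists_isConvexValue (lab_ne h.rotation u) (h.ne (a := u) (b := y)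
    (by rw [ne_eq, Fin.ext_iff]; omega)) (lab_ne h.rotation y)
  have huyx := four (i := u) (j := y) (l := x) (by omega) (by omega) (by omega)
  have hW : D.InSide s (lab u) (lab y) k₂ (lab w) := by
    refine Or.inr (Or.inr (Or.inr (hk₂.windAt_eq_of_germ_eq huyx ?_ hx hwu
      (h.germ_eq ?_ ?_ ?_ ?_ ?_ ?_))))
    · exact four (by omega) (by omega) (by omega)
    all_goals simp only [Btw, Fin.ext_iff, ne_eq]; omega
  have hxu : D.windAt s (lab w) (lab y) (D.vert (lab x)) = D.germ s (lab w) (lab y) (lab u) :=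
    hk₂.windAt_eq_germ huyx (four (by omega) (by omega) (by omega)) hW
      (Or.inr (Or.inr (Or.inl rfl))) (hk₂.ne huyx (Or.inl hx))
  have hXx : D.crossNum s (lab x) (lab w) (lab y) ≠ 0 := by
    rw [ne_eq, crossNum_eq_zero_iff_of_windAt_eq hxu]
    apply h.germ_ne
    all_goals simp only [Btw, Fin.ext_iff, ne_eq]; omega
  have hXa : D.crossNum s (lab w) (lab a) (lab y) ≠ 0 := by
    by_cases hyb : y.val = b.val
    · rwa [Fin.ext hyb]
    rw [ne_eq, crossNum_eq_zero_iff_of_windAt_eq (hk.windAt_eq_germ' hwabk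
      (four (by omega) (by omega) (by omega)) (Or.inr (Or.inl rfl)) hY hwk), eq_comm]
    apply h.germ_ne
    all_goals simp only [Btw, Fin.ext_iff, ne_eq]; omega
  obtain ⟨k₃, hk₃⟩ := h.convex.exists_isConvexValue (lab_ne h.rotation w) (h.ne (a := w) (b := y)
    (by rw [ne_eq, Fin.ext_iff]; omega)) (lab_ne h.rotation y)
  have hwyx := four (i := w) (j := y) (l := x) (by omega) (by omega) (by omega)
  have hwya := four (i := w) (j := y) (l := a) (by omega) (by omega) (by omega)
  have hwa' := hk₃.ne hwya (Or.inr (Or.inr (by rwa [crossNum_symm_right, neg_ne_zero])))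
  have heq := hk₃.eq_of_ne hwya.ab hwya.bc hwya.ac (vert_notMem_tri hwyx) (vert_notMem_tri hwya)
    (hk₃.ne hwyx (Or.inl hXx)) hwa'
  rw [hxu, ← SimpleDrawing.germ_eq
    (crossNum_exclusive (four (by omega) (by omega) (by omega)) hXa)] at heq
  revert heq
  rw [imp_false, eq_comm]
  apply h.germ_ne
  all_goals simp only [Btw, Fin.ext_iff, ne_eq]; omega

/-- An edge `z y` crosses no star edge, if `u y` crosses the star edge of `z` but none of those
strictly between `z` and `y`. -/
theorem not_crosses_of_maximal (huz : u < z) (hzy : z < y)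
    (hz : D.crossNum s (lab z) (lab u) (lab y) ≠ 0)
    (hX : ∀ x, D.Crosses s(lab u, lab y) s(lab x, s) → D.crossNum s (lab x) (lab u) (lab y) ≠ 0)
    (hX' : ∀ x, D.Crosses s(lab z, lab y) s(lab x, s) → D.crossNum s (lab x) (lab z) (lab y) ≠ 0)
    (hmax : ∀ x, z < x → x < y → D.crossNum s (lab x) (lab u) (lab y) = 0) (x : Fin (n - 1)) :
    ¬D.Crosses s(lab z, lab y) s(lab x, s) := by
  intro hM
  have hx := hX' x hM
  have h4 := hM.four (h.ne hzy.ne) (lab_ne h.rotation x).symm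
  have hxz : x ≠ z := fun hh ↦ h4.ac (hh ▸ rfl)
  have hxy : x ≠ y := fun hh ↦ h4.bc (hh ▸ rfl)
  have huy := huz.trans hzy
  have hu0 : D.crossNum s (lab u) (lab z) (lab y) = 0 :=
    crossNum_exclusive (h.four huz.ne' hzy.ne huy.ne) hz
  have hxu : x ≠ u := by
    rintro rfl
    exact hx hu0
  obtain ⟨k, hk⟩ := h.convex.exists_isConvexValue (lab_ne h.rotation z) (h.ne hzy.ne)
    (lab_ne h.rotation y)
  have hzyu := h.four hzy.ne huz.ne' huy.ne'
  have hzyx := h.four hzy.ne hxz.symm hxy.symm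
  have heq := hk.eq_of_ne hzyu.ab hzyu.bc hzyu.ac (vert_notMem_tri hzyx) (vert_notMem_tri hzyu)
    (hk.ne hzyx (Or.inl hx))
    (hk.ne hzyu (Or.inr (Or.inr (by rwa [crossNum_symm_right, neg_ne_zero]))))
  rw [← SimpleDrawing.germ_eq hu0] at heq
  have hne : D.germ s (lab z) (lab y) (lab x) ≠ D.germ s (lab z) (lab y) (lab u) := by
    rwa [ne_eq, ← crossNum_eq_zero_iff_of_windAt_eq heq]
  have hbtw : z < x ∧ x < y := by
    by_contra hcon
    refine hne (h.germ_eq hzy.ne hxz hxy huz.ne huy.ne ?_)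
    simp only [Btw, Fin.lt_def, Fin.ext_iff, ne_eq] at *
    omega
  have hx0 := hmax x hbtw.1 hbtw.2
  have hd₁ : Disjoint (D.arc s (lab x)) (D.arc (lab u) (lab y)) :=
    h.disjoint_of_not_crosses huy.ne hxu.symm hxy.symm fun hh ↦ hX x hh hx0
  have hd₂ : Disjoint (D.arc s (lab u)) (D.arc (lab z) (lab y)) :=
    h.disjoint_of_not_crosses hzy.ne huz.ne' huy.ne' fun hh ↦ hX' u hh hu0
  rw [crosses_iff h4] at hM
  obtain ⟨p, hp, hpx⟩ := not_disjoint_iff.1 hM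
  rw [D.arc_symm] at hpx
  have huyx := h.four huy.ne hxu.symm hxy.symm
  have huyz := h.four huy.ne huz.ne hzy.ne'
  have e₁ := (windAt_of_disjoint huyx hd₁ hpx fun hh ↦
    vert_notMem h4.ab h4.ad.symm h4.bd.symm (hh ▸ hp)).2
  have e₂ := (windAt_of_disjoint (q := p) (⟨huyz.ac.symm, huyz.bc.symm, huyz.cd, huyz.ab, huyz.ad,
    huyz.bd⟩ : Four (lab y) s (lab u) (lab z)) ?_ (D.arc_symm _ _ ▸ hp) ?_).2
  · rw [← windAt_rotate (lab y), ← windAt_rotate (lab y), e₁, ← SimpleDrawing.germ_eq hx0,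
      eq_comm] at e₂
    rw [ne_eq, crossNum_eq_zero_iff_of_windAt_eq e₂] at hz
    refine hz (h.germ_eq ?_ ?_ ?_ ?_ ?_ ?_) <;>
      simp only [Btw, Fin.lt_def, Fin.ext_iff, ne_eq] at * <;> omega
  · rw [D.arc_symm (lab y)]
    exact hd₂.symm
  · rintro rfl
    exact vert_notMem hzyx.ad (lab_ne h.rotation y).symm hzyx.cd hpx

end IsStarLabeling
end SimpleDrawing

namespace SimpleDrawing

variable {n : ℕ} {D : SimpleDrawing n} {s i j p q r : Fin n} {lab : Fin (n - 1) → Fin n}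
  {a b t u w x y z : Fin (n - 1)} {k : ℂ}

namespace IsStarLabeling

theorem not_crosses_of_succ (h : IsStarLabeling D s lab) (huz : u < z) (htz : t.val = z.val + 1)
    (hty : t < y) (hz : D.crossNum s (lab z) (lab u) (lab y) ≠ 0)
    (ht : D.crossNum s (lab t) (lab u) (lab y) = 0)
    (hX : D.Crosses s(lab t, lab y) s(lab z, s) → D.crossNum s (lab z) (lab t) (lab y) ≠ 0)
    (hzy : ∀ x, ¬D.Crosses s(lab z, lab y) s(lab x, s)) (hxz : x ≤ z) :
    ¬D.Crosses s(lab t, lab y) s(lab x, s) := by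
  simp only [Fin.lt_def, Fin.le_def] at huz hty hxz
  have four : ∀ {i j l : Fin (n - 1)}, i.val ≠ j.val → i.val ≠ l.val → j.val ≠ l.val →
      Four s (lab i) (lab j) (lab l) := fun h1 h2 h3 ↦
    h.four (fun hh ↦ h1 (hh ▸ rfl)) (fun hh ↦ h2 (hh ▸ rfl)) (fun hh ↦ h3 (hh ▸ rfl))
  have huyz := four (i := u) (j := y) (l := z) (by omega) (by omega) (by omega)
  have htyz := four (i := t) (j := y) (l := z) (by omega) (by omega) (by omega)
  obtain ⟨k, hk⟩ := h.convex.exists_isConvexValue huyz.ab huyz.bc huyz.ac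
  have hT : D.InSide s (lab u) (lab y) k (lab t) := by
    refine Or.inr (Or.inr (Or.inr (hk.windAt_eq_of_germ_eq huyz ?_ hz ht
      (h.germ_eq ?_ ?_ ?_ ?_ ?_ ?_))))
    · exact four (by omega) (by omega) (by omega)
    all_goals simp only [Btw, Fin.ext_iff, ne_eq]; omega
  have htz' : ¬D.Crosses s(lab t, lab y) s(lab z, s) := by
    refine fun hM ↦ hX hM ?_
    rw [crossNum_eq_zero_iff_of_windAt_eq (hk.windAt_eq_germ huyz
      (four (by omega) (by omega) (by omega)) hT (Or.inr (Or.inr (Or.inl rfl)))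
      (hk.ne huyz (Or.inl hz)))]
    apply h.germ_eq
    all_goals simp only [Btw, Fin.ext_iff, ne_eq]; omega
  rcases eq_or_ne x z with rfl | hne
  · exact htz'
  rw [ne_eq, Fin.ext_iff] at hne
  intro hM
  have htyx := four (i := t) (j := y) (l := x) (by omega) (by omega) (by omega)
  have hzyx := four (i := z) (j := y) (l := x) (by omega) (by omega) (by omega)
  have hzyt := four (i := z) (j := y) (l := t) (by omega) (by omega) (by omega)
  rw [crosses_iff ⟨htyx.bc, htyx.bd, htyx.ab.symm, htyx.cd, htyx.ac.symm, htyx.ad.symm⟩] at hM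
  obtain ⟨p, hp, hpx⟩ := not_disjoint_iff.1 hM
  rw [D.arc_symm _ s] at hpx
  have hd : ∀ v, v.val ≠ z.val → v.val ≠ y.val →
      Disjoint (D.arc s (lab v)) (D.arc (lab z) (lab y)) := fun v h1 h2 ↦
    h.disjoint_of_not_crosses (fun hh ↦ hzyx.bc (hh ▸ rfl)) (fun hh ↦ h1 (hh ▸ rfl))
      (fun hh ↦ h2 (hh ▸ rfl)) (hzy v)
  have hd' : Disjoint (D.arc s (lab z)) (D.arc (lab t) (lab y)) :=
    h.disjoint_of_not_crosses (fun hh ↦ htyz.bc (hh ▸ rfl)) (fun hh ↦ htyz.bd (hh ▸ rfl))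
      (fun hh ↦ htyz.cd (hh ▸ rfl)) htz'
  have hdx := hd x (by omega) (by omega)
  have hdt := hd t (by omega) (by omega)
  have e₁ := (windAt_of_disjoint hzyx hdx hpx fun hh ↦
    vert_notMem htyx.bc htyx.ab htyx.ac (hh ▸ hp)).2
  have e₂ := (windAt_of_disjoint (q := p) (⟨hzyt.ac.symm, hzyt.bc.symm, hzyt.cd, hzyt.ab, hzyt.ad,
    hzyt.bd⟩ : Four (lab y) s (lab z) (lab t)) (by rw [D.arc_symm (lab y)]; exact hd'.symm)
    (D.arc_symm _ _ ▸ hp) ?_).2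
  · rw [← windAt_rotate (lab y), ← windAt_rotate (lab y), e₁,
      ← SimpleDrawing.germ_eq (crossNum_eq_zero hzyx.ad hzyx.bc hdx),
      ← SimpleDrawing.germ_eq (crossNum_eq_zero hzyt.ad hzyt.bc hdt), eq_comm] at e₂
    revert e₂
    apply h.germ_ne
    all_goals simp only [Btw, Fin.ext_iff, ne_eq]; omega
  · rintro rfl
    exact vert_notMem hzyx.ad hzyx.ac.symm hzyx.cd hpx

end IsStarLabeling
end SimpleDrawing

/-- With `m ≥ 2` bad edges as in the standard labeling (sidedness and nestedness), blocks
`L i` and `R i`, `u ∈ L i`, `y ∈ R i`, and `z` the largest element of `L i` with `z > u` such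
that `{lab u, lab y}` crosses the star edge `{lab z, vs}`: (a) the edge `{lab z, lab y}` is
not star-crossing, and (b) the edge `{lab (z+1), lab y}` crosses no star edge `{lab x', vs}`
with `x' ∈ L i` and `x' ≤ z`. -/
theorem edges_from_left_to_right (n : ℕ) (D : SimpleDrawing n) (hD : D.Convex)
    (vs : Fin n) (lab : Fin (n - 1) → Fin n) (hlab : D.IsRotationLabeling vs lab)
    (m : ℕ) (hm : 2 ≤ m) (v wL wR : ℕ → Fin (n - 1))
    (hmono : ∀ i j, i < j → j < m → v i < v j)
    (hbadall : ∀ x w, D.BadWitness vs lab x w → ∃ i, i < m ∧ x = v i)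
    (hwitL : ∀ i, i < m → D.BadWitness vs lab (v i) (wL i))
    (hwitR : ∀ i, i < m → D.BadWitness vs lab (v i) (wR i))
    (hwitLR : ∀ i, i < m → ∀ w, D.BadWitness vs lab (v i) w → wL i ≤ w ∧ w ≤ wR i)
    (hside : ∀ x w, D.BadWitness vs lab x w → w < x)
    (hnest : ∀ x x' w w', D.BadWitness vs lab x w → D.BadWitness vs lab x' w' → x < x' → w' < w)
    (i : ℕ) (hi : i + 1 < m) (u y z : Fin (n - 1))
    (hu : wR (i+1) < u ∧ u < wL i)
    (hy : finCycSucc (v i) ≤ y ∧ y ≤ v (i+1))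
    (hz : wR (i+1) < z ∧ z < wL i) (huz : u < z)
    (hcross : D.Crosses s(lab u, lab y) s(lab z, vs))
    (hmax : ∀ z' : Fin (n - 1), (wR (i+1) < z' ∧ z' < wL i) → u < z' →
      D.Crosses s(lab u, lab y) s(lab z', vs) → z' ≤ z) :
    ¬D.StarCrossing vs lab z y ∧
    ∀ x' : Fin (n - 1), (wR (i+1) < x' ∧ x' < wL i) → x' ≤ z →
      ¬D.Crosses s(lab (finCycSucc z), lab y) s(lab x', vs) := by
  have hi' : i < m := by omega
  have hab := hmono i (i + 1) (by omega) hi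
  have hwi := hside _ _ (hwitL i hi')
  have hbv : (finCycSucc (v i)).val = (v i).val + 1 := by
    rcases finCycSucc_val (v i) with h | h
    · exact h.2
    · have := (v (i + 1)).isLt
      rw [Fin.lt_def] at hab
      omega
  have h7 : 7 ≤ n - 1 := by
    by_contra hn
    have hv := (v (i + 1)).isLt
    have hr := hwitR (i + 1) hi
    have h0 : wR (i + 1) = finCycSucc (v (i + 1)) := by
      have := finCycSucc_val (v (i + 1))
      simp only [Fin.lt_def, Fin.le_def, Fin.ext_iff] at *
      omega
    refine (SimpleDrawing.Crosses.four hr ?_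
      (SimpleDrawing.IsStarLabeling.lab_ne hlab _).symm).bc (congrArg lab h0.symm)
    refine fun he ↦ (hside _ _ hr).ne ?_
    rw [h0, hlab.1 he.symm]
  have h : SimpleDrawing.IsStarLabeling D vs lab := ⟨hD, hlab, h7⟩
  have hleft : ∀ x w, D.BadWitness vs lab x w → wL i ≤ x := by
    intro x w hb
    rcases lt_or_ge x (v i) with hx | hx
    · exact (hnest _ _ _ _ hb (hwitL i hi') hx).le.trans (hside _ _ hb).le
    · exact hwi.le.trans hx
  have hwit : ∀ x w, D.BadWitness vs lab x w →
      (x ≤ v i ∧ wL i ≤ w) ∨ (v (i + 1) ≤ x ∧ w ≤ wR (i + 1)) := by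
    intro x w hb
    obtain ⟨j, hj, rfl⟩ := hbadall x w hb
    rcases lt_trichotomy j i with hji | rfl | hji
    · have := hmono j i hji hi'
      exact Or.inl ⟨this.le, (hnest _ _ _ _ hb (hwitL i hi') this).le⟩
    · exact Or.inl ⟨le_rfl, (hwitLR _ hj _ hb).1⟩
    · rcases (Nat.succ_le_of_lt hji).eq_or_lt with rfl | hji
      · exact Or.inr ⟨le_rfl, (hwitLR _ hj _ hb).2⟩
      · have := hmono (i + 1) j hji hj
        exact Or.inr ⟨this.le, (hnest _ _ _ _ (hwitR _ hi) hb this).le⟩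
  have hpred : ∀ x : Fin (n - 1), ∃ e, finCycSucc e = x ∧ (0 < x.val → e < x) := by
    intro x
    have hx := x.isLt
    rcases Nat.eq_zero_or_pos x.val with h0 | h0
    · refine ⟨⟨n - 2, by omega⟩, Fin.ext ?_, by omega⟩
      rcases finCycSucc_val (⟨n - 2, by omega⟩ : Fin (n - 1)) with h1 | h1 <;> simp only at h1 <;>
        omega
    · refine ⟨⟨x - 1, by omega⟩, Fin.ext ?_, fun _ ↦ Fin.lt_def.2 (by simp only; omega)⟩
      rcases finCycSucc_val (⟨x - 1, by omega⟩ : Fin (n - 1)) with h1 | h1 <;> simp only at h1 <;>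
        omega
  have huy : u < y := by simp only [Fin.lt_def, Fin.le_def] at *; omega
  have hzy : z < y := by simp only [Fin.lt_def, Fin.le_def] at *; omega
  have hyw : ∀ x, ¬D.BadWitness vs lab x y := by
    intro x hb
    have h1 := hwit x y hb
    have h2 := hside x y hb
    simp only [Fin.lt_def, Fin.le_def] at *
    omega
  have hLw : ∀ p, wR (i + 1) < p → p < wL i → ∀ x, ¬D.BadWitness vs lab x p := by
    intro p h1 h2 x hb
    have h3 := hwit x p hb
    simp only [Fin.lt_def, Fin.le_def] at *
    omega
  have hpy : ∀ p, wR (i + 1) < p → p < wL i → p ≠ y → ∀ x,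
      D.Crosses s(lab p, lab y) s(lab x, vs) → D.crossNum vs (lab x) (lab p) (lab y) ≠ 0 := by
    intro p h1 h2 h3 x hM
    obtain ⟨e, he, -⟩ := hpred x
    exact h.crossNum_ne_zero he (hLw p h1 h2 x) (hyw x) (hLw p h1 h2 e) (hyw e) h3 hM
  have hw : D.crossNum vs (lab (wL i)) (lab (v i)) (lab (finCycSucc (v i))) ≠ 0 := by
    obtain ⟨e, he, hew⟩ := hpred (wL i)
    have hew := hew (by rw [Fin.lt_def] at hz; omega)
    have hlt : ∀ x p, x ≤ wL i → v i ≤ p → ¬D.BadWitness vs lab x p := fun x p h1 h2 hb ↦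
      absurd (hside x p hb) (not_lt.2 (h1.trans (hwi.le.trans h2)))
    have hv' : v i ≤ finCycSucc (v i) := by rw [Fin.le_def]; omega
    refine h.crossNum_ne_zero he (hlt _ _ le_rfl le_rfl) (hlt _ _ le_rfl hv')
      (hlt _ _ hew.le le_rfl) (hlt _ _ hew.le hv') ?_ (hwitL i hi')
    rw [ne_eq, Fin.ext_iff]
    omega
  have hvX : ∀ p, p ≠ v i → p ≠ finCycSucc (v i) → ¬D.BadWitness vs lab (v i) p →
      D.crossNum vs (lab p) (lab (v i)) (lab (finCycSucc (v i))) = 0 := fun p h1 h2 h3 ↦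
    h.crossNum_eq_zero_of_not_crosses (by rw [ne_eq, Fin.ext_iff]; omega) h1.symm h2.symm h3
  have hE : ∀ x, wL i ≤ x → x < y → D.crossNum vs (lab x) (lab u) (lab y) = 0 := by
    intro x
    refine h.crossNum_eq_zero_of_le hu.2 hwi hbv hy.1 hw (hvX u (hu.2.trans hwi).ne ?_
      (hLw u hu.1 hu.2 _)) fun hyb ↦ hvX y ?_ hyb (hyw _)
    all_goals simp only [ne_eq, Fin.ext_iff, Fin.lt_def, Fin.le_def] at *; omega
  have hX : ∀ x, z < x → x < y → D.crossNum vs (lab x) (lab u) (lab y) = 0 := by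
    intro x hzx hxy
    rcases le_or_gt (wL i) x with hx | hx
    · exact hE x hx hxy
    by_contra hne
    exact hzx.not_ge (hmax x ⟨hz.1.trans hzx, hx⟩ (huz.trans hzx)
      (h.crosses_of_crossNum huy.ne (huz.trans hzx).ne hxy.ne' hne))
  have hzX := hpy u hu.1 hu.2 huy.ne z hcross
  have ha := h.not_crosses_of_maximal huz hzy hzX (hpy u hu.1 hu.2 huy.ne)
    (hpy z hz.1 hz.2 hzy.ne) hX
  refine ⟨fun ⟨x, hx⟩ ↦ ha x hx, fun x _ hxz ↦ ?_⟩
  have htz : (finCycSucc z).val = z.val + 1 := by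
    rcases finCycSucc_val z with h1 | h1
    · exact h1.2
    · have := y.isLt
      rw [Fin.lt_def] at hzy
      omega
  have hty : finCycSucc z < y := by simp only [Fin.lt_def, Fin.le_def] at *; omega
  refine h.not_crosses_of_succ huz htz hty hzX (hX _ (by rw [Fin.lt_def]; omega) hty) ?_ ha hxz
  obtain ⟨e, he, hez⟩ := hpred z
  have hez := hez (by rw [Fin.lt_def] at huz; omega)
  have hzb : ∀ e p, e ≤ z → ¬D.BadWitness vs lab e p := fun e p h1 hb ↦
    absurd (hleft e p hb) (not_le.2 (h1.trans_lt hz.2))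
  exact h.crossNum_ne_zero he (hzb _ _ le_rfl) (hzb _ _ le_rfl) (hzb _ _ hez.le) (hzb _ _ hez.le)
    hty.ne
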